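/- There exist absolute constants C₁ and C₂ such that the following holds. Let a be a nonzero integer, set s = 2 if a is odd and s = 1 if a is even, and let ℰ be any nonempty set of primes. Then uniformly for all nonzero integers a, all x ≥ 2|a|, all such ℰ, and all positive integers k, #{ primes p with −a < p ≤ x : (p+a)/s ∈ 𝒬(ℰ) and ω((p+a)/s) = k } ≤ C₁ · (|a|/φ(|a|)) · π(x) · (E(x) + C₂)^{k−1} / ((k−1)! · log x). -/

import Mathlib

namespace BoundingSieve

open Finset Nat ArithmeticFunction
open scoped ArithmeticFunction.Moebius

variable {s : BoundingSieve}

theorem sum_moebius_between {P l k : ℕ} (hP : P ≠ 0) (hk : k ∣ P) (hsq : Squarefree k) :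
    (∑ d ∈ divisors P, if l ∣ d ∧ d ∣ k then (μ d : ℝ) else 0) =
      if k = l then (μ l : ℝ) else 0 := by
  have hk0 : k ≠ 0 := hsq.ne_zero
  by_cases hlk : l ∣ k
  · obtain ⟨e, rfl⟩ := hlk
    have hl0 : l ≠ 0 := left_ne_zero_of_mul hk0
    have he0 : e ≠ 0 := right_ne_zero_of_mul hk0
    have hset : {d ∈ divisors P | l ∣ d ∧ d ∣ l * e} = (divisors e).image (l * ·) := by
      ext d
      simp only [mem_filter, mem_divisors, mem_image]
      constructor
      · rintro ⟨_, ⟨f, rfl⟩, h⟩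
        exact ⟨f, ⟨Nat.dvd_of_mul_dvd_mul_left (Nat.pos_of_ne_zero hl0) h, he0⟩, rfl⟩
      · rintro ⟨f, ⟨hf, _⟩, rfl⟩
        exact ⟨⟨(Nat.mul_dvd_mul_left l hf).trans hk, hP⟩, dvd_mul_right _ _,
          Nat.mul_dvd_mul_left l hf⟩
    rw [← sum_filter, hset, sum_image (fun a _ b _ h => Nat.eq_of_mul_eq_mul_left
      (Nat.pos_of_ne_zero hl0) h)]
    have hmul : ∀ f ∈ divisors e, (μ (l * f) : ℝ) = (μ l : ℝ) * (μ f : ℝ) := by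
      intro f hf
      have hsq' : Squarefree (l * f) :=
        hsq.squarefree_of_dvd (Nat.mul_dvd_mul_left l (dvd_of_mem_divisors hf))
      rw [isMultiplicative_moebius.map_mul_of_coprime (coprime_of_squarefree_mul hsq')]
      push_cast; ring
    rw [sum_congr rfl hmul, ← mul_sum]
    have h1 : (∑ f ∈ divisors e, (μ f : ℝ)) = if e = 1 then 1 else 0 := by
      have := congrArg (fun f => f e) (coe_moebius_mul_coe_zeta (R := ℝ))
      simpa only [coe_mul_zeta_apply, one_apply, intCoe_apply] using this
    rw [h1]
    have : l * e = l ↔ e = 1 := by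
      constructor
      · intro h; exact Nat.eq_of_mul_eq_mul_left (Nat.pos_of_ne_zero hl0) (by rw [h, mul_one])
      · rintro rfl; simp
    simp [this]
  · rw [if_neg (by rintro rfl; exact hlk dvd_rfl)]
    apply sum_eq_zero
    intro d _
    rw [if_neg]
    rintro ⟨h1, h2⟩
    exact hlk (h1.trans h2)

/-- The denominator in the Selberg sieve. -/
noncomputable def selbergDenom (s : BoundingSieve) (D : ℝ) : ℝ :=
  ∑ l ∈ divisors s.prodPrimes with ((l : ℕ) : ℝ) ≤ D, s.selbergTerms l

/-- The optimal weights in the Selberg sieve, supported on divisors up to `D`. -/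
noncomputable def selbergWeight (s : BoundingSieve) (D : ℝ) (d : ℕ) : ℝ :=
  (s.nu d)⁻¹ * (μ d : ℝ) * (selbergDenom s D)⁻¹ *
    ∑ k ∈ divisors s.prodPrimes with d ∣ k ∧ ((k : ℕ) : ℝ) ≤ D, s.selbergTerms k

theorem one_le_selbergDenom {D : ℝ} (hD : 1 ≤ D) : 1 ≤ selbergDenom s D := by
  have h1 : s.selbergTerms 1 = 1 := selbergTerms_isMultiplicative.map_one
  rw [selbergDenom, ← h1]
  refine single_le_sum (f := fun l => s.selbergTerms l) (fun l hl => ?_) ?_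
  · exact (selbergTerms_pos (dvd_of_mem_divisors (mem_filter.mp hl).1)).le
  · simp [prodPrimes_ne_zero, hD]

theorem selbergWeight_one {D : ℝ} (hD : 1 ≤ D) : selbergWeight s D 1 = 1 := by
  have := one_le_selbergDenom (s := s) hD
  have h0 : selbergDenom s D ≠ 0 := by linarith
  have h1 : s.nu 1 = 1 := s.nu_mult.map_one
  simp only [selbergWeight, h1, one_dvd, true_and]
  rw [← selbergDenom]
  simp [h0]

theorem sum_nu_mul_selbergWeight {D : ℝ} {l : ℕ} (hl : l ∣ s.prodPrimes) :
    (∑ d ∈ divisors s.prodPrimes, if l ∣ d then s.nu d * selbergWeight s D d else 0) =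
      if (l : ℝ) ≤ D then (μ l : ℝ) * s.selbergTerms l * (selbergDenom s D)⁻¹ else 0 := by
  have h1 : ∀ d ∈ divisors s.prodPrimes,
      (if l ∣ d then s.nu d * selbergWeight s D d else 0) =
      ∑ k ∈ divisors s.prodPrimes with ((k : ℕ) : ℝ) ≤ D, (selbergDenom s D)⁻¹ * s.selbergTerms k *
        (if l ∣ d ∧ d ∣ k then (μ d : ℝ) else 0) := by
    intro d hd
    have hnu := nu_ne_zero (dvd_of_mem_divisors hd)
    split_ifs with hld
    · rw [selbergWeight, show s.nu d * ((s.nu d)⁻¹ * (μ d : ℝ) * (selbergDenom s D)⁻¹ *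
        ∑ k ∈ divisors s.prodPrimes with d ∣ k ∧ ((k : ℕ) : ℝ) ≤ D, s.selbergTerms k) =
          (μ d : ℝ) * (selbergDenom s D)⁻¹ *
        ∑ k ∈ divisors s.prodPrimes with d ∣ k ∧ ((k : ℕ) : ℝ) ≤ D, s.selbergTerms k by
          field_simp]
      rw [sum_filter, sum_filter, mul_sum]
      refine sum_congr rfl fun k _ => ?_
      by_cases h1 : d ∣ k <;> by_cases h2 : ((k : ℕ) : ℝ) ≤ D <;> simp [h1, h2, hld]
      ring
    · symm
      apply sum_eq_zero
      intro k _
      simp [hld]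
  rw [sum_congr rfl h1, sum_comm]
  have h2 : ∀ k ∈ {k ∈ divisors s.prodPrimes | ((k : ℕ) : ℝ) ≤ D},
      ∑ d ∈ divisors s.prodPrimes, (selbergDenom s D)⁻¹ * s.selbergTerms k *
        (if l ∣ d ∧ d ∣ k then (μ d : ℝ) else 0) =
      if k = l then (μ l : ℝ) * s.selbergTerms l * (selbergDenom s D)⁻¹ else 0 := by
    intro k hk
    have hkP := dvd_of_mem_divisors (mem_filter.mp hk).1
    rw [← mul_sum, sum_moebius_between prodPrimes_ne_zero hkP (squarefree_of_dvd_prodPrimes hkP)]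
    split_ifs with h
    · subst h; ring
    · simp
  rw [sum_congr rfl h2, sum_ite_eq']
  simp [hl, prodPrimes_ne_zero]

theorem mainSum_selbergWeight {D : ℝ} (hD : 1 ≤ D) :
    s.mainSum (lambdaSquared (selbergWeight s D)) = (selbergDenom s D)⁻¹ := by
  have := one_le_selbergDenom (s := s) hD
  have h0 : selbergDenom s D ≠ 0 := by linarith
  rw [mainSum_lambdaSquared_eq_sum_mul_sum_sq]
  have h1 : ∀ l ∈ divisors s.prodPrimes, (s.selbergTerms l)⁻¹ *
        (∑ d ∈ divisors s.prodPrimes, if l ∣ d then s.nu d * selbergWeight s D d else 0) ^ 2 =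
        if (l : ℝ) ≤ D then s.selbergTerms l * (selbergDenom s D)⁻¹ ^ 2 else 0 := by
    intro l hl
    have hlP := dvd_of_mem_divisors hl
    rw [sum_nu_mul_selbergWeight hlP]
    have hg := (selbergTerms_pos hlP).ne'
    have hmu : (μ l : ℝ) ^ 2 = 1 := by
      have := moebius_sq_eq_one_of_squarefree (squarefree_of_dvd_prodPrimes hlP)
      exact_mod_cast this
    split_ifs
    · rw [mul_pow, mul_pow, hmu]
      field_simp
    · simp
  rw [sum_congr rfl h1, ← sum_filter, ← sum_mul, ← selbergDenom]
  field_simp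

theorem abs_selbergWeight_le {D : ℝ} (hD : 1 ≤ D) {d : ℕ} (hd : d ∣ s.prodPrimes)
    (hnu : (1 : ℝ) / d ≤ s.nu d) :
    |selbergWeight s D d| ≤ if (d : ℝ) ≤ D then D else 0 := by
  have hS := one_le_selbergDenom (s := s) hD
  have hd0 : (0 : ℝ) < d := by
    have := ne_zero_of_dvd_ne_zero prodPrimes_ne_zero hd
    positivity
  split_ifs with hdD
  · have hsum : ∑ k ∈ divisors s.prodPrimes with d ∣ k ∧ ((k : ℕ) : ℝ) ≤ D, s.selbergTerms k ≤
        selbergDenom s D := by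
      refine sum_le_sum_of_subset_of_nonneg ?_ fun l hl _ => ?_
      · intro k; simp only [mem_filter]; tauto
      · exact (selbergTerms_pos (dvd_of_mem_divisors (mem_filter.mp hl).1)).le
    have hsum0 : 0 ≤ ∑ k ∈ divisors s.prodPrimes with d ∣ k ∧ ((k : ℕ) : ℝ) ≤ D, s.selbergTerms k :=
      sum_nonneg fun l hl => (selbergTerms_pos (dvd_of_mem_divisors (mem_filter.mp hl).1)).le
    have hmu : |(μ d : ℝ)| ≤ 1 := by exact_mod_cast abs_moebius_le_one (n := d)
    have hnu0 := nu_pos_of_dvd_prodPrimes hd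
    rw [selbergWeight, abs_mul, abs_mul, abs_mul, abs_of_nonneg hsum0,
      abs_of_pos (inv_pos.mpr hnu0),
      abs_of_pos (inv_pos.mpr (show 0 < selbergDenom s D by linarith))]
    have hinv : (s.nu d)⁻¹ ≤ d := by
      rw [inv_le_comm₀ hnu0 hd0, ← one_div]; exact hnu
    calc (s.nu d)⁻¹ * |(μ d : ℝ)| * (selbergDenom s D)⁻¹ * _
        ≤ D * 1 * (selbergDenom s D)⁻¹ * selbergDenom s D := by
          gcongr
          exact hinv.trans hdD
      _ = D := by field_simp
  · rw [selbergWeight]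
    have : {k ∈ divisors s.prodPrimes | d ∣ k ∧ ((k : ℕ) : ℝ) ≤ D} = ∅ := by
      rw [filter_eq_empty_iff]
      rintro k hk ⟨h1, h2⟩
      have hk0 : k ≠ 0 := (pos_of_mem_divisors hk).ne'
      have : (d : ℝ) ≤ k := by exact_mod_cast Nat.le_of_dvd (Nat.pos_of_ne_zero hk0) h1
      linarith
    simp [this]

theorem card_filter_le_of_pos {t : Finset ℕ} (h0 : ∀ d ∈ t, d ≠ 0) {D : ℝ} (hD : 0 ≤ D) :
    (#{d ∈ t | ((d : ℕ) : ℝ) ≤ D} : ℝ) ≤ D := by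
  have : {d ∈ t | ((d : ℕ) : ℝ) ≤ D} ⊆ Icc 1 ⌊D⌋₊ := by
    intro d hd
    rw [mem_filter] at hd
    rw [mem_Icc]
    exact ⟨Nat.one_le_iff_ne_zero.mpr (h0 d hd.1), Nat.le_floor hd.2⟩
  calc (#{d ∈ t | ((d : ℕ) : ℝ) ≤ D} : ℝ) ≤ #(Icc 1 ⌊D⌋₊) := by exact_mod_cast card_le_card this
    _ = ⌊D⌋₊ := by simp
    _ ≤ D := Nat.floor_le hD

theorem abs_lambdaSquared_selbergWeight_le {D : ℝ} (hD : 1 ≤ D)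
    (hnu : ∀ d, d ∣ s.prodPrimes → (1 : ℝ) / d ≤ s.nu d) {d : ℕ} (hd : d ∣ s.prodPrimes) :
    |lambdaSquared (selbergWeight s D) d| ≤ if (d : ℝ) ≤ D ^ 2 then D ^ 4 else 0 := by
  have hD0 : 0 ≤ D := by linarith
  have hd0 : d ≠ 0 := ne_zero_of_dvd_ne_zero prodPrimes_ne_zero hd
  have hb : ∀ d1 ∈ divisors d, |selbergWeight s D d1| ≤ if (d1 : ℝ) ≤ D then D else 0 :=
    fun d1 h1 => abs_selbergWeight_le hD ((dvd_of_mem_divisors h1).trans hd)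
      (hnu _ ((dvd_of_mem_divisors h1).trans hd))
  have key : |lambdaSquared (selbergWeight s D) d| ≤
      ∑ d1 ∈ divisors d with ((d1 : ℕ) : ℝ) ≤ D, ∑ d2 ∈ divisors d with ((d2 : ℕ) : ℝ) ≤ D,
        if (d : ℝ) ≤ D ^ 2 then D * D else 0 := by
    rw [lambdaSquared]
    refine (abs_sum_le_sum_abs _ _).trans ?_
    rw [sum_filter]
    refine sum_le_sum fun d1 h1 => ?_
    refine (abs_sum_le_sum_abs _ _).trans ?_
    rw [sum_filter, ite_sum_zero]
    refine sum_le_sum fun d2 h2 => ?_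
    have hb1 := hb d1 h1
    have hb2 := hb d2 h2
    by_cases hl : d = Nat.lcm d1 d2
    · rw [if_pos hl, abs_mul]
      by_cases hd1 : ((d1 : ℕ) : ℝ) ≤ D
      · by_cases hd2 : ((d2 : ℕ) : ℝ) ≤ D
        · have : ((d : ℕ) : ℝ) ≤ D ^ 2 := by
            have h3 : d ≤ d1 * d2 := hl ▸ Nat.le_of_dvd (Nat.mul_pos (pos_of_mem_divisors h1)
              (pos_of_mem_divisors h2)) (Nat.lcm_dvd_mul d1 d2)
            calc (d : ℝ) ≤ d1 * d2 := by exact_mod_cast h3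
              _ ≤ D * D := by gcongr
              _ = D ^ 2 := by ring
          simp only [hd1, hd2, this, if_true] at hb1 hb2 ⊢
          gcongr
        · simp only [hd2, if_false] at hb2 ⊢
          have : |selbergWeight s D d2| = 0 := le_antisymm hb2 (abs_nonneg _)
          simp [this]
      · simp only [hd1, if_false] at hb1 ⊢
        have : |selbergWeight s D d1| = 0 := le_antisymm hb1 (abs_nonneg _)
        simp [this]
    · rw [if_neg hl, abs_zero]
      split_ifs <;> positivity
  refine key.trans ?_
  have hc := card_filter_le_of_pos (t := divisors d) (fun e he => (pos_of_mem_divisors he).ne') hD0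
  rw [sum_const, sum_const, nsmul_eq_mul, nsmul_eq_mul]
  split_ifs
  · calc _ ≤ D * (D * (D * D)) := by gcongr
      _ = D ^ 4 := by ring
  · simp

/-- A version of Selberg's upper bound sieve with a crude error term. -/
theorem siftedSum_le_selberg {D : ℝ} (hD : 1 ≤ D)
    (hnu : ∀ d, d ∣ s.prodPrimes → (1 : ℝ) / d ≤ s.nu d)
    (hrem : ∀ d, d ∣ s.prodPrimes → |s.rem d| ≤ d) :
    s.siftedSum ≤ s.totalMass / selbergDenom s D + D ^ 8 := by
  have hD0 : 0 ≤ D := by linarith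
  refine (siftedSum_le_mainSum_errSum_of_upperMoebius _
    (upperMoebius_lambdaSquared _ (selbergWeight_one (s := s) hD))).trans ?_
  rw [mainSum_selbergWeight hD, div_eq_mul_inv]
  gcongr
  rw [errSum]
  calc ∑ d ∈ divisors s.prodPrimes, |lambdaSquared (selbergWeight s D) d| * |s.rem d|
      ≤ ∑ d ∈ divisors s.prodPrimes, if (d : ℝ) ≤ D ^ 2 then D ^ 4 * D ^ 2 else 0 := by
        refine sum_le_sum fun d hd => ?_
        have hdP := dvd_of_mem_divisors hd
        have h1 := abs_lambdaSquared_selbergWeight_le hD hnu hdP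
        have h2 := hrem d hdP
        split_ifs at h1 ⊢ with h
        · gcongr
          exact h2.trans h
        · have : |lambdaSquared (selbergWeight s D) d| = 0 := le_antisymm h1 (abs_nonneg _)
          simp [this]
    _ = #{d ∈ divisors s.prodPrimes | ((d : ℕ) : ℝ) ≤ D ^ 2} * (D ^ 4 * D ^ 2) := by
        rw [← sum_filter, sum_const, nsmul_eq_mul]
    _ ≤ D ^ 2 * (D ^ 4 * D ^ 2) := by
        gcongr
        exact card_filter_le_of_pos (fun e he => (pos_of_mem_divisors he).ne') (by positivity)
    _ = D ^ 8 := by ring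

end BoundingSieve

namespace SievedShiftedPrimes

open Finset

/-- The sum of `∏ p ∈ C, f p` over subsets `C` of `P` whose product is at most `t`. -/
noncomputable def subsetSum (f : ℕ → ℝ) (P : Finset ℕ) (t : ℕ) : ℝ :=
  ∑ C ∈ P.powerset, if ∏ p ∈ C, p ≤ t then ∏ p ∈ C, f p else 0

theorem subsetSum_nonneg {f : ℕ → ℝ} {P : Finset ℕ} (hf : ∀ p ∈ P, 0 ≤ f p) (t : ℕ) :
    0 ≤ subsetSum f P t := by
  refine sum_nonneg fun C hC => ?_
  split_ifs
  · exact prod_nonneg fun p hp => hf p (mem_powerset.mp hC hp)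
  · rfl

theorem subsetSum_mono {f : ℕ → ℝ} {P : Finset ℕ} (hf : ∀ p ∈ P, 0 ≤ f p) {t u : ℕ}
    (htu : t ≤ u) : subsetSum f P t ≤ subsetSum f P u := by
  refine sum_le_sum fun C hC => ?_
  have : 0 ≤ ∏ p ∈ C, f p := prod_nonneg fun p hp => hf p (mem_powerset.mp hC hp)
  split_ifs with h1 h2
  · rfl
  · omega
  · exact this
  · rfl

theorem subsetSum_insert {f : ℕ → ℝ} {P : Finset ℕ} {p : ℕ} (hp : p ∉ P) (hp0 : 0 < p) (t : ℕ) :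
    subsetSum f (insert p P) t = subsetSum f P t + f p * subsetSum f P (t / p) := by
  rw [subsetSum, sum_powerset_insert hp, ← subsetSum]
  congr 1
  rw [subsetSum, mul_sum]
  refine sum_congr rfl fun C hC => ?_
  have hpC : p ∉ C := fun h => hp (mem_powerset.mp hC h)
  rw [prod_insert hpC, prod_insert hpC]
  simp only [Nat.le_div_iff_mul_le hp0, mul_comm p]
  split_ifs <;> simp

theorem sum_inv_le_subsetSum (P : Finset ℕ) (hP : ∀ p ∈ P, p.Prime) (t : ℕ) :
    ∑ n ∈ (Icc 1 t).filter (fun n => n.primeFactors ⊆ P), (1 : ℝ) / n ≤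
      subsetSum (fun p => 1 / ((p : ℝ) - 1)) P t := by
  induction P using Finset.induction_on generalizing t with
  | empty =>
    have hsub : (Icc 1 t).filter (fun n => n.primeFactors ⊆ ∅) ⊆ (Icc 1 t).filter (· = 1) := by
      intro n hn
      simp only [mem_filter, mem_Icc, subset_empty, Nat.primeFactors_eq_empty] at hn ⊢
      omega
    calc _ ≤ ∑ n ∈ (Icc 1 t).filter (· = 1), (1 : ℝ) / n :=
          sum_le_sum_of_subset_of_nonneg hsub fun _ _ _ => by positivity
      _ ≤ _ := by
        rw [subsetSum, sum_filter, sum_ite_eq']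
        simp
  | insert p P hpP ih =>
    have hp : p.Prime := hP p (mem_insert_self _ _)
    have hP' : ∀ q ∈ P, q.Prime := fun q hq => hP q (mem_insert_of_mem hq)
    have hp1 : (1 : ℝ) < p := by exact_mod_cast hp.one_lt
    induction t using Nat.strong_induction_on with
    | _ t iht =>
      rcases Nat.eq_zero_or_pos t with rfl | ht
      · simpa using subsetSum_nonneg (P := insert p P) (f := fun p => 1 / ((p : ℝ) - 1))
          (fun q hq => by
            have : (1 : ℝ) < q := by exact_mod_cast (hP q hq).one_lt
            have : 0 < (q : ℝ) - 1 := by linarith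
            positivity) 0
      have hfP : ∀ q ∈ P, 0 ≤ 1 / ((q : ℝ) - 1) := fun q hq => by
        have : (1 : ℝ) < q := by exact_mod_cast (hP' q hq).one_lt
        have : 0 < (q : ℝ) - 1 := by linarith
        positivity
      have hdec : (Icc 1 t).filter (fun n => n.primeFactors ⊆ insert p P) ⊆
          (Icc 1 t).filter (fun n => n.primeFactors ⊆ P) ∪
          ((Icc 1 (t / p)).filter (fun n => n.primeFactors ⊆ insert p P)).image (p * ·) := by
        intro n hn
        simp only [mem_filter, mem_Icc, mem_union, mem_image] at hn ⊢
        obtain ⟨⟨hn1, hnt⟩, hsub⟩ := hn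
        by_cases hpn : p ∣ n
        · right
          obtain ⟨m, rfl⟩ := hpn
          have hm0 : m ≠ 0 := by rintro rfl; simp at hn1
          refine ⟨m, ⟨⟨by omega, ?_⟩, ?_⟩, rfl⟩
          · rw [Nat.le_div_iff_mul_le hp.pos, mul_comm]; exact hnt
          · refine subset_trans ?_ hsub
            exact Nat.primeFactors_mono (dvd_mul_left _ _) (by omega)
        · left
          refine ⟨⟨hn1, hnt⟩, fun q hq => ?_⟩
          rcases mem_insert.mp (hsub hq) with rfl | h
          · exact absurd (Nat.dvd_of_mem_primeFactors hq) hpn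
          · exact h
      have h1 := ih hP' t
      have h2 := iht (t / p) (Nat.div_lt_self ht hp.one_lt)
      rw [subsetSum_insert hpP hp.pos] at h2 ⊢
      have h3 : subsetSum (fun p => 1 / ((p : ℝ) - 1)) P (t / p / p) ≤
          subsetSum (fun p => 1 / ((p : ℝ) - 1)) P (t / p) :=
        subsetSum_mono hfP (Nat.div_le_self _ _)
      calc _ ≤ ∑ n ∈ (Icc 1 t).filter (fun n => n.primeFactors ⊆ P) ∪
          ((Icc 1 (t / p)).filter (fun n => n.primeFactors ⊆ insert p P)).image (p * ·),
            (1 : ℝ) / n := sum_le_sum_of_subset_of_nonneg hdec fun _ _ _ => by positivity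
        _ ≤ ∑ n ∈ (Icc 1 t).filter (fun n => n.primeFactors ⊆ P), (1 : ℝ) / n +
          ∑ n ∈ ((Icc 1 (t / p)).filter (fun n => n.primeFactors ⊆ insert p P)).image (p * ·),
            (1 : ℝ) / n := by
          rw [← sum_union_inter]
          exact le_add_of_nonneg_right (sum_nonneg fun _ _ => by positivity)
        _ = ∑ n ∈ (Icc 1 t).filter (fun n => n.primeFactors ⊆ P), (1 : ℝ) / n +
          1 / p * ∑ n ∈ (Icc 1 (t / p)).filter (fun n => n.primeFactors ⊆ insert p P),
            (1 : ℝ) / n := by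
          rw [sum_image fun a _ b _ h => Nat.eq_of_mul_eq_mul_left hp.pos h, mul_sum]
          congr 1
          refine sum_congr rfl fun n _ => ?_
          push_cast
          rw [one_div_mul_one_div]
        _ ≤ subsetSum (fun p => 1 / ((p : ℝ) - 1)) P t + 1 / p *
            (subsetSum (fun p => 1 / ((p : ℝ) - 1)) P (t / p) + 1 / ((p : ℝ) - 1) *
              subsetSum (fun p => 1 / ((p : ℝ) - 1)) P (t / p)) := by
          have : 0 < (p : ℝ) - 1 := by linarith
          gcongr
          refine h2.trans ?_
          gcongr
        _ = _ := by
          have : (p : ℝ) - 1 ≠ 0 := by linarith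
          field_simp
          ring

/-- The sum of `(∏ p ∈ A, f p) * (∏ p ∈ B, f p)` over pairs of subsets with product of all elements
at most `t`. -/
noncomputable def pairSum (f : ℕ → ℝ) (P : Finset ℕ) (t : ℕ) : ℝ :=
  ∑ A ∈ P.powerset, ∑ B ∈ P.powerset,
    if (∏ p ∈ A, p) * ∏ p ∈ B, p ≤ t then (∏ p ∈ A, f p) * ∏ p ∈ B, f p else 0

theorem pairSum_nonneg {f : ℕ → ℝ} {P : Finset ℕ} (hf : ∀ p ∈ P, 0 ≤ f p) (t : ℕ) :
    0 ≤ pairSum f P t := by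
  refine sum_nonneg fun A hA => sum_nonneg fun B hB => ?_
  have h1 : 0 ≤ ∏ p ∈ A, f p := prod_nonneg fun p hp => hf p (mem_powerset.mp hA hp)
  have h2 : 0 ≤ ∏ p ∈ B, f p := prod_nonneg fun p hp => hf p (mem_powerset.mp hB hp)
  split_ifs
  · positivity
  · rfl

theorem pairSum_mono {f : ℕ → ℝ} {P : Finset ℕ} (hf : ∀ p ∈ P, 0 ≤ f p) {t u : ℕ}
    (htu : t ≤ u) : pairSum f P t ≤ pairSum f P u := by
  refine sum_le_sum fun A hA => sum_le_sum fun B hB => ?_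
  have h1 : 0 ≤ ∏ p ∈ A, f p := prod_nonneg fun p hp => hf p (mem_powerset.mp hA hp)
  have h2 : 0 ≤ ∏ p ∈ B, f p := prod_nonneg fun p hp => hf p (mem_powerset.mp hB hp)
  split_ifs
  · rfl
  · omega
  · positivity
  · rfl

theorem pairSum_insert {f : ℕ → ℝ} {P : Finset ℕ} {p : ℕ} (hp : p ∉ P) (hp0 : 0 < p) (t : ℕ) :
    pairSum f (insert p P) t = pairSum f P t + 2 * f p * pairSum f P (t / p) +
      f p ^ 2 * pairSum f P (t / p / p) := by
  have hins : ∀ A ∈ P.powerset, p ∉ A := fun A hA h => hp (mem_powerset.mp hA h)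
  rw [pairSum, sum_powerset_insert hp]
  simp_rw [sum_powerset_insert hp]
  simp_rw [pairSum, mul_sum, ← sum_add_distrib]
  refine sum_congr rfl fun A hA => sum_congr rfl fun B hB => ?_
  rw [prod_insert (hins A hA), prod_insert (hins A hA), prod_insert (hins B hB),
    prod_insert (hins B hB)]
  simp only [Nat.le_div_iff_mul_le hp0]
  rw [show (∏ x ∈ A, x) * (p * ∏ x ∈ B, x) = (∏ x ∈ A, x) * (∏ x ∈ B, x) * p by ring,
    show p * (∏ x ∈ A, x) * (∏ x ∈ B, x) = (∏ x ∈ A, x) * (∏ x ∈ B, x) * p by ring,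
    show p * (∏ x ∈ A, x) * (p * ∏ x ∈ B, x) = (∏ x ∈ A, x) * (∏ x ∈ B, x) * p * p by ring]
  split_ifs <;> ring

theorem pairSum_le {H : ℕ → Prop} [DecidablePred H] {w g : ℕ → ℝ} (P : Finset ℕ)
    (hP : ∀ p ∈ P, 0 < p) (hw : ∀ p ∈ P, 0 ≤ w p) (hg : ∀ p ∈ P, H p → w p ≤ g p)
    (hg' : ∀ p ∈ P, ¬ H p → 2 * w p + w p ^ 2 ≤ g p) (t : ℕ) :
    pairSum w P t ≤ (∏ p ∈ P with H p, (1 + w p)) * subsetSum g P t := by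
  induction P using Finset.induction_on generalizing t with
  | empty => simp [pairSum, subsetSum]
  | insert p P hpP ih =>
    have hp := hP p (mem_insert_self _ _)
    have hwp := hw p (mem_insert_self _ _)
    have hwP : ∀ q ∈ P, 0 ≤ w q := fun q hq => hw q (mem_insert_of_mem hq)
    have hgP : ∀ q ∈ P, 0 ≤ g q := fun q hq => by
      have h1 := hg q (mem_insert_of_mem hq)
      have h2 := hg' q (mem_insert_of_mem hq)
      have h3 := hwP q hq
      by_cases h : H q
      · linarith [h1 h]
      · nlinarith [h2 h]
    have ih' := ih (fun q hq => hP q (mem_insert_of_mem hq)) hwP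
      (fun q hq => hg q (mem_insert_of_mem hq)) (fun q hq => hg' q (mem_insert_of_mem hq))
    have i1 := ih' t
    have i2 := ih' (t / p)
    have m1 : pairSum w P (t / p / p) ≤ pairSum w P (t / p) :=
      pairSum_mono hwP (Nat.div_le_self _ _)
    have m2 : pairSum w P (t / p) ≤ pairSum w P t := pairSum_mono hwP (Nat.div_le_self _ _)
    have hnn : 0 ≤ ∏ p ∈ P with H p, (1 + w p) :=
      prod_nonneg fun q hq => by linarith [hwP q (mem_filter.mp hq).1]
    have hs : 0 ≤ subsetSum g P (t / p) := subsetSum_nonneg hgP _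
    have hps : 0 ≤ pairSum w P (t / p) := pairSum_nonneg hwP _
    rw [pairSum_insert hpP hp, subsetSum_insert hpP hp, filter_insert]
    by_cases h : H p
    · rw [if_pos h, prod_insert (by simp [hpP])]
      have hgp := hg p (mem_insert_self _ _) h
      calc _ ≤ pairSum w P t + w p * pairSum w P (t / p) + w p * pairSum w P t +
            w p ^ 2 * pairSum w P (t / p) := by nlinarith [mul_le_mul_of_nonneg_left m2 hwp]
        _ = (1 + w p) * (pairSum w P t + w p * pairSum w P (t / p)) := by ring
        _ ≤ (1 + w p) * ((∏ p ∈ P with H p, (1 + w p)) * subsetSum g P t +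
            g p * ((∏ p ∈ P with H p, (1 + w p)) * subsetSum g P (t / p))) := by
          have hgp0 : 0 ≤ g p := hwp.trans hgp
          gcongr
        _ = _ := by ring
    · rw [if_neg h]
      have hgp := hg' p (mem_insert_self _ _) h
      calc _ ≤ pairSum w P t + (2 * w p + w p ^ 2) * pairSum w P (t / p) := by
            nlinarith [mul_le_mul_of_nonneg_left m1 (sq_nonneg (w p))]
        _ ≤ (∏ p ∈ P with H p, (1 + w p)) * subsetSum g P t +
            g p * ((∏ p ∈ P with H p, (1 + w p)) * subsetSum g P (t / p)) := by
          have hgp0 : 0 ≤ g p := by nlinarith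
          gcongr
        _ = _ := by ring

theorem subsetSum_sq_le_pairSum {w : ℕ → ℝ} {P : Finset ℕ} (hw : ∀ p ∈ P, 0 ≤ w p) (M : ℕ) :
    subsetSum w P M ^ 2 ≤ pairSum w P (M * M) := by
  rw [sq, subsetSum, pairSum, sum_mul_sum]
  refine sum_le_sum fun A hA => sum_le_sum fun B hB => ?_
  have h1 : 0 ≤ ∏ p ∈ A, w p := prod_nonneg fun p hp => hw p (mem_powerset.mp hA hp)
  have h2 : 0 ≤ ∏ p ∈ B, w p := prod_nonneg fun p hp => hw p (mem_powerset.mp hB hp)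
  by_cases hA' : ∏ p ∈ A, p ≤ M
  · by_cases hB' : ∏ p ∈ B, p ≤ M
    · rw [if_pos hA', if_pos hB', if_pos (Nat.mul_le_mul hA' hB')]
    · rw [if_neg hB', mul_zero]
      split_ifs <;> positivity
  · rw [if_neg hA', zero_mul]
    split_ifs <;> positivity

theorem log_sq_le_subsetSum {H : ℕ → Prop} [DecidablePred H] {g : ℕ → ℝ} (P : Finset ℕ)
    (hP : ∀ p ∈ P, p.Prime) (hg : ∀ p ∈ P, H p → 1 / ((p : ℝ) - 1) ≤ g p)
    (hg' : ∀ p ∈ P, ¬ H p → 2 * (1 / ((p : ℝ) - 1)) + (1 / ((p : ℝ) - 1)) ^ 2 ≤ g p) (M : ℕ)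
    (hM : ∀ p, p.Prime → p ≤ M → p ∈ P) :
    Real.log (M + 1) ^ 2 ≤
      (∏ p ∈ P with H p, (1 + 1 / ((p : ℝ) - 1))) * subsetSum g P (M * M) := by
  have hw : ∀ p ∈ P, 0 ≤ 1 / ((p : ℝ) - 1) := fun p hp => by
    have : (1 : ℝ) < p := by exact_mod_cast (hP p hp).one_lt
    have : 0 < (p : ℝ) - 1 := by linarith
    positivity
  have h1 : Real.log (M + 1) ≤ subsetSum (fun p => 1 / ((p : ℝ) - 1)) P M := by
    have h2 := log_add_one_le_harmonic M
    refine le_trans ?_ (sum_inv_le_subsetSum P hP M)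
    rw [filter_true_of_mem]
    · rw [harmonic_eq_sum_Icc] at h2
      push_cast at h2
      simpa only [one_div] using h2
    · intro n hn q hq
      have hq' := Nat.le_of_mem_primeFactors hq
      exact hM q (Nat.prime_of_mem_primeFactors hq) (hq'.trans (mem_Icc.mp hn).2)
  have h0 : 0 ≤ Real.log (M + 1) := Real.log_nonneg (by linarith [M.cast_nonneg (α := ℝ)])
  calc _ ≤ subsetSum (fun p => 1 / ((p : ℝ) - 1)) P M ^ 2 := by gcongr
    _ ≤ pairSum (fun p => 1 / ((p : ℝ) - 1)) P (M * M) := subsetSum_sq_le_pairSum hw M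
    _ ≤ _ := pairSum_le (w := fun p => 1 / ((p : ℝ) - 1)) P (fun p hp => (hP p hp).pos) hw hg hg' _

/-- The proportion of residues `r` mod `d` with `r * (h * r - a) = 0`. -/
noncomputable def rootDensity (h : ℕ) (a : ℤ) : ArithmeticFunction ℝ :=
  ⟨fun d => (Nat.card {r : ZMod d // r * (h * r - a) = 0} : ℝ) / d, by simp⟩

theorem rootDensity_apply (h : ℕ) (a : ℤ) (d : ℕ) :
    rootDensity h a d = (Nat.card {r : ZMod d // r * (h * r - a) = 0} : ℝ) / d := rfl

theorem rootDensity_isMultiplicative (h : ℕ) (a : ℤ) : (rootDensity h a).IsMultiplicative := by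
  constructor
  · rw [rootDensity_apply]
    have : Nat.card {r : ZMod 1 // r * (h * r - a) = 0} = 1 := by
      rw [Nat.card_eq_one_iff_unique]
      exact ⟨⟨fun x y => Subtype.ext (Subsingleton.elim _ _)⟩,
        ⟨⟨0, by simp⟩⟩⟩
    rw [this]
    norm_num
  · intro m n hmn
    simp only [rootDensity_apply]
    have e : {r : ZMod (m * n) // r * (h * r - a) = 0} ≃
        {r : ZMod m // r * (h * r - a) = 0} × {r : ZMod n // r * (h * r - a) = 0} := by
      refine ((ZMod.chineseRemainder hmn).toEquiv.subtypeEquiv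
        (q := fun z : ZMod m × ZMod n =>
          z.1 * (h * z.1 - a) = 0 ∧ z.2 * (h * z.2 - a) = 0) ?_).trans
        (Equiv.subtypeProdEquivProd (p := fun r : ZMod m => r * (h * r - a) = 0)
          (q := fun r : ZMod n => r * (h * r - a) = 0))
      intro r
      have h1 : r * (h * r - a) = 0 ↔ (ZMod.chineseRemainder hmn) (r * (h * r - a)) = 0 :=
        EmbeddingLike.map_eq_zero_iff.symm
      rw [h1, map_mul, map_sub, map_mul, map_natCast, map_intCast, Prod.ext_iff]
      simp
    rw [Nat.card_congr e, Nat.card_prod]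
    push_cast
    rw [mul_div_mul_comm]

theorem one_div_le_rootDensity (h : ℕ) (a : ℤ) {d : ℕ} (hd : d ≠ 0) :
    (1 : ℝ) / d ≤ rootDensity h a d := by
  have : NeZero d := ⟨hd⟩
  rw [rootDensity_apply]
  have : 1 ≤ Nat.card {r : ZMod d // r * (h * r - a) = 0} := by
    have : Nonempty {r : ZMod d // r * (h * r - a) = 0} := ⟨⟨0, by simp⟩⟩
    exact Nat.card_pos
  gcongr
  exact_mod_cast this

theorem card_roots_of_dvd {h : ℕ} {a : ℤ} (hco : IsCoprime (h : ℤ) a) {p : ℕ} (hp : p.Prime)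
    (hdvd : (p : ℤ) ∣ h * a) : Nat.card {r : ZMod p // r * (h * r - a) = 0} = 1 := by
  have := Fact.mk hp
  rw [Nat.card_eq_one_iff_unique]
  refine ⟨⟨fun x y => Subtype.ext ?_⟩, ⟨⟨0, by simp⟩⟩⟩
  have key : ∀ r : ZMod p, r * (h * r - a) = 0 → r = 0 := by
    intro r hr
    by_contra hr0
    have h2 : (h : ZMod p) * r - a = 0 := (mul_eq_zero.mp hr).resolve_left hr0
    have h3 : (h : ZMod p) * a = 0 := by
      have := (ZMod.intCast_zmod_eq_zero_iff_dvd (h * a) p).mpr hdvd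
      exact_mod_cast this
    obtain ⟨u, v, huv⟩ := hco
    have h4 : (u : ZMod p) * h + v * a = 1 := by exact_mod_cast congrArg (Int.cast : ℤ → ZMod p) huv
    rcases mul_eq_zero.mp h3 with h5 | h5
    · rw [h5] at h2 h4
      have : (a : ZMod p) = 0 := by simpa using h2
      rw [this] at h4
      simp at h4
    · rw [h5] at h2 h4
      have : (h : ZMod p) = 0 := by
        rcases mul_eq_zero.mp (by simpa using h2 : (h : ZMod p) * r = 0) with h6 | h6
        · exact h6
        · exact absurd h6 hr0
      rw [this] at h4
      simp at h4
  rw [key x x.2, key y y.2]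

theorem card_roots_of_not_dvd {h : ℕ} {a : ℤ} {p : ℕ} (hp : p.Prime)
    (hdvd : ¬ (p : ℤ) ∣ h * a) : Nat.card {r : ZMod p // r * (h * r - a) = 0} = 2 := by
  have := Fact.mk hp
  have hha : (h : ZMod p) * a ≠ 0 := by
    intro h3
    apply hdvd
    rw [← ZMod.intCast_zmod_eq_zero_iff_dvd]
    exact_mod_cast h3
  have hh : (h : ZMod p) ≠ 0 := left_ne_zero_of_mul hha
  have ha : (a : ZMod p) ≠ 0 := right_ne_zero_of_mul hha
  have hset : {r : ZMod p | r * (h * r - a) = 0} =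
      ({0, (a : ZMod p) / h} : Set (ZMod p)) := by
    ext r
    simp only [Set.mem_ofPred_eq, mul_eq_zero, Set.mem_insert_iff, Set.mem_singleton_iff]
    rw [sub_eq_zero, eq_div_iff hh, mul_comm r]
  have h2 : Nat.card {r : ZMod p // r * (h * r - a) = 0} =
      Set.ncard {r : ZMod p | r * (h * r - a) = 0} := rfl
  rw [h2, hset, Set.ncard_pair]
  exact (div_ne_zero ha hh).symm

theorem count_mul_add {f : ℕ → Prop} [DecidablePred f] {d : ℕ} (hf : ∀ n, f (n + d) ↔ f n)
    (t r : ℕ) : Nat.count f (d * t + r) = t * Nat.count f d + Nat.count f r := by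
  have hper : ∀ t n, f (d * t + n) ↔ f n := by
    intro t
    induction t with
    | zero => simp
    | succ t ih =>
      intro n
      rw [show d * (t + 1) + n = (d * t + n) + d by ring, hf, ih]
  induction t generalizing r with
  | zero => simp
  | succ t ih =>
    rw [show d * (t + 1) + r = d * t + (d + r) by ring, ih, Nat.count_add]
    have : Nat.count (fun k => f (d + k)) r = Nat.count f r := by
      congr 1
      ext n
      rw [add_comm, hf]
    rw [this]
    ring

theorem count_periodic_sub_le {f : ℕ → Prop} [DecidablePred f] {d : ℕ} (hd : 0 < d)
    (hf : ∀ n, f (n + d) ↔ f n) (N : ℕ) :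
    |(Nat.count f N : ℝ) - (Nat.count f d : ℝ) / d * N| ≤ d := by
  have hd' : (0 : ℝ) < d := by exact_mod_cast hd
  have h1 := count_mul_add hf (N / d) (N % d)
  rw [Nat.div_add_mod] at h1
  have h2 : Nat.count f (N % d) ≤ N % d := Nat.count_le _
  have h3 : Nat.count f d ≤ d := Nat.count_le _
  have h4 : N % d < d := Nat.mod_lt _ hd
  have h5 : (N : ℝ) = d * (N / d : ℕ) + (N % d : ℕ) := by exact_mod_cast (Nat.div_add_mod N d).symm
  rw [h1]
  push_cast
  have h6 : ((N / d : ℕ) : ℝ) * (Nat.count f d) + (Nat.count f (N % d)) -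
      (Nat.count f d : ℝ) / d * N =
      (Nat.count f (N % d) : ℝ) - (Nat.count f d : ℝ) / d * (N % d : ℕ) := by
    conv_lhs => rw [h5]
    field_simp
    ring
  rw [h6]
  have h2' : (Nat.count f (N % d) : ℝ) ≤ (N % d : ℕ) := by exact_mod_cast h2
  have h4' : ((N % d : ℕ) : ℝ) ≤ d := by exact_mod_cast h4.le
  have h7 : (Nat.count f d : ℝ) / d ≤ 1 := by
    rw [div_le_one hd']; exact_mod_cast h3
  have h8 : 0 ≤ (Nat.count f d : ℝ) / d := by positivity
  have h9 : (0 : ℝ) ≤ (N % d : ℕ) := by positivity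
  have h10 : (0 : ℝ) ≤ Nat.count f (N % d) := by positivity
  rw [abs_le]
  constructor <;> nlinarith

theorem count_roots_eq_card (h : ℕ) (a : ℤ) {d : ℕ} (hd : d ≠ 0) :
    Nat.count (fun n : ℕ => d ∣ ((n : ℤ) * (h * n - a)).natAbs) d =
      Nat.card {r : ZMod d // r * (h * r - a) = 0} := by
  have : NeZero d := ⟨hd⟩
  have hiff : ∀ n : ℕ, d ∣ ((n : ℤ) * (h * n - a)).natAbs ↔
      (n : ZMod d) * (h * n - a) = 0 := by
    intro n
    rw [← Int.natCast_dvd, ← ZMod.intCast_zmod_eq_zero_iff_dvd]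
    push_cast
    rfl
  rw [Nat.count_eq_card_filter_range, Nat.card_eq_fintype_card, Fintype.card_subtype]
  refine card_bij (fun n _ => (n : ZMod d)) ?_ ?_ ?_
  · intro n hn
    simp only [mem_filter, mem_univ, true_and]
    exact (hiff n).mp (mem_filter.mp hn).2
  · intro m hm n hn hmn
    have h1 := mem_range.mp (mem_filter.mp hm).1
    have h2 := mem_range.mp (mem_filter.mp hn).1
    rw [ZMod.natCast_eq_natCast_iff'] at hmn
    rwa [Nat.mod_eq_of_lt h1, Nat.mod_eq_of_lt h2] at hmn
  · intro r hr
    refine ⟨r.val, ?_, ZMod.natCast_zmod_val r⟩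
    rw [mem_filter, mem_range, hiff, ZMod.natCast_zmod_val]
    exact ⟨ZMod.val_lt r, (mem_filter.mp hr).2⟩

theorem rootDensity_lt_one {h : ℕ} {a : ℤ} (hco : IsCoprime (h : ℤ) a) (h2 : (2 : ℤ) ∣ h * a)
    {p : ℕ} (hp : p.Prime) : rootDensity h a p < 1 := by
  rw [rootDensity_apply, div_lt_one (by exact_mod_cast hp.pos)]
  by_cases hdvd : (p : ℤ) ∣ h * a
  · rw [card_roots_of_dvd hco hp hdvd]
    exact_mod_cast hp.one_lt
  · rw [card_roots_of_not_dvd hp hdvd]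
    have : p ≠ 2 := by rintro rfl; exact hdvd h2
    have := hp.two_le
    exact_mod_cast (by omega : 2 < p)

/-- The sieve problem of removing from `{0, …, N - 1}` all `n` for which `n * (h * n - a)` has a
prime factor at most `D`. -/
noncomputable def linearPairSieve (h : ℕ) (a : ℤ) (hco : IsCoprime (h : ℤ) a)
    (h2 : (2 : ℤ) ∣ h * a) (N D : ℕ) : BoundingSieve where
  support := (range N).image fun n : ℕ => ((n : ℤ) * (h * n - a)).natAbs
  prodPrimes := primorial D
  prodPrimes_squarefree := squarefree_primorial D
  weights m := #{n ∈ range N | (((n : ℕ) : ℤ) * (h * n - a)).natAbs = m}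
  weights_nonneg _ := by positivity
  totalMass := N
  nu := rootDensity h a
  nu_mult := rootDensity_isMultiplicative h a
  nu_pos_of_prime p hp _ := lt_of_lt_of_le (by have := hp.pos; positivity)
    (one_div_le_rootDensity h a hp.ne_zero)
  nu_lt_one_of_prime p hp _ := rootDensity_lt_one hco h2 hp

theorem sum_image_fiber_card (F : ℕ → ℕ) (Q : ℕ → Prop) [DecidablePred Q] (N : ℕ) :
    ∑ m ∈ (range N).image F, (if Q m then (#{n ∈ range N | F n = m} : ℝ) else 0) =
      #{n ∈ range N | Q (F n)} := by
  rw [card_eq_sum_card_fiberwise (f := F) (t := (range N).image F)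
    (fun n hn => mem_image_of_mem F (mem_filter.mp hn).1)]
  push_cast
  refine sum_congr rfl fun m _ => ?_
  rw [filter_filter]
  split_ifs with h
  · congr 2
    refine filter_congr fun n _ => ⟨fun hn => ⟨hn ▸ h, hn⟩, fun hn => hn.2⟩
  · symm
    rw [Nat.cast_eq_zero, card_eq_zero, filter_eq_empty_iff]
    rintro n - ⟨h1, h2⟩
    exact h (h2 ▸ h1)

section

variable {h : ℕ} {a : ℤ} (hco : IsCoprime (h : ℤ) a) (h2 : (2 : ℤ) ∣ h * a) (N D : ℕ)

theorem abs_rem_linearPairSieve_le {d : ℕ} (hd : d ∣ (linearPairSieve h a hco h2 N D).prodPrimes) :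
    |(linearPairSieve h a hco h2 N D).rem d| ≤ d := by
  have hd0 : d ≠ 0 := ne_zero_of_dvd_ne_zero BoundingSieve.prodPrimes_ne_zero hd
  have h1 : (linearPairSieve h a hco h2 N D).multSum d =
      Nat.count (fun n : ℕ => d ∣ ((n : ℤ) * (h * n - a)).natAbs) N := by
    rw [Nat.count_eq_card_filter_range]
    exact sum_image_fiber_card (fun n : ℕ => ((n : ℤ) * (h * n - a)).natAbs) (fun m => d ∣ m) N
  rw [BoundingSieve.rem, h1]
  have h3 := count_periodic_sub_le (f := fun n : ℕ => d ∣ ((n : ℤ) * (h * n - a)).natAbs)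
    (Nat.pos_of_ne_zero hd0) (fun n => by
      rw [← Int.natCast_dvd, ← Int.natCast_dvd]
      have : (((n + d : ℕ) : ℤ)) * (h * ((n + d : ℕ) : ℤ) - a) =
          d * (h * n - a + h * (n + d)) + (n : ℤ) * (h * n - a) := by
        push_cast; ring
      rw [this]
      exact Int.dvd_add_right (dvd_mul_right _ _)) N
  rw [count_roots_eq_card h a hd0] at h3
  exact h3

theorem selbergTerms_linearPairSieve_of_dvd {p : ℕ} (hp : p.Prime) (hdvd : (p : ℤ) ∣ h * a) :
    1 / ((p : ℝ) - 1) ≤ (linearPairSieve h a hco h2 N D).selbergTerms p := by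
  have hp1 : (1 : ℝ) < p := by exact_mod_cast hp.one_lt
  have hnu : (linearPairSieve h a hco h2 N D).nu p = 1 / p := by
    change rootDensity h a p = _
    rw [rootDensity_apply, card_roots_of_dvd hco hp hdvd]
    simp
  rw [BoundingSieve.selbergTerms_apply, hp.primeFactors, prod_singleton, hnu]
  have : (p : ℝ) - 1 ≠ 0 := by linarith
  apply le_of_eq
  field_simp

theorem selbergTerms_linearPairSieve_of_not_dvd {p : ℕ} (hp : p.Prime)
    (hdvd : ¬ (p : ℤ) ∣ h * a) :
    2 * (1 / ((p : ℝ) - 1)) + (1 / ((p : ℝ) - 1)) ^ 2 ≤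
      (linearPairSieve h a hco h2 N D).selbergTerms p := by
  have hp2 : p ≠ 2 := by rintro rfl; exact hdvd h2
  have hp3 : (3 : ℝ) ≤ p := by
    have := hp.two_le
    exact_mod_cast (by omega : 3 ≤ p)
  have hnu : (linearPairSieve h a hco h2 N D).nu p = 2 / p := by
    change rootDensity h a p = _
    rw [rootDensity_apply, card_roots_of_not_dvd hp hdvd]
    simp
  rw [BoundingSieve.selbergTerms_apply, hp.primeFactors, prod_singleton, hnu]
  have h1 : 0 < (p : ℝ) - 1 := by linarith
  have h3 : 0 < (p : ℝ) - 2 := by linarith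
  have h4 : 2 / (p : ℝ) * (1 - 2 / (p : ℝ))⁻¹ = 2 / ((p : ℝ) - 2) := by
    field_simp
  have h5 : 2 * (1 / ((p : ℝ) - 1)) + (1 / ((p : ℝ) - 1)) ^ 2 =
      (2 * (p - 1) + 1) / ((p : ℝ) - 1) ^ 2 := by
    field_simp
  rw [h4, h5, div_le_div_iff₀ (by positivity) h3]
  nlinarith

theorem subsetSum_le_selbergDenom (t : ℕ) :
    subsetSum (linearPairSieve h a hco h2 N D).selbergTerms {p ∈ range (D + 1) | p.Prime} t ≤
      BoundingSieve.selbergDenom (linearPairSieve h a hco h2 N D) t := by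
  set s := linearPairSieve h a hco h2 N D
  have hP : s.prodPrimes = primorial D := rfl
  rw [subsetSum, ← sum_filter, BoundingSieve.selbergDenom]
  have hprime : ∀ C ⊆ (range (D + 1)).filter Nat.Prime, ∀ p ∈ C, p.Prime :=
    fun C hC p hp => (mem_filter.mp (hC hp)).2
  refine le_trans (le_of_eq ?_) (sum_le_sum_of_subset_of_nonneg (s := image (fun C => ∏ p ∈ C, p)
    {C ∈ ((range (D + 1)).filter Nat.Prime).powerset | ∏ p ∈ C, p ≤ t}) ?_ ?_)
  · rw [sum_image]
    · refine sum_congr rfl fun C hC => ?_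
      have hC' := mem_powerset.mp (mem_filter.mp hC).1
      rw [BoundingSieve.selbergTerms_isMultiplicative.map_prod]
      intro p hp q hq hpq
      exact (Nat.coprime_primes (hprime C hC' p hp) (hprime C hC' q hq)).mpr hpq
    · intro C hC B hB hCB
      rw [mem_coe, mem_filter, mem_powerset] at hC hB
      rw [← Nat.primeFactors_prod (hprime C hC.1), ← Nat.primeFactors_prod (hprime B hB.1)]
      exact congrArg _ hCB
  · intro d hd
    obtain ⟨C, hC, rfl⟩ := mem_image.mp hd
    rw [mem_filter, mem_powerset] at hC
    rw [mem_filter, Nat.mem_divisors]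
    refine ⟨⟨?_, BoundingSieve.prodPrimes_ne_zero⟩, by exact_mod_cast hC.2⟩
    rw [hP, primorial]
    exact prod_dvd_prod_of_subset _ _ _ hC.1
  · intro d hd _
    exact (BoundingSieve.selbergTerms_pos (Nat.dvd_of_mem_divisors (mem_filter.mp hd).1)).le

end

theorem prod_one_add_le_div_totient {m : ℕ} (hm : m ≠ 0) (P : Finset ℕ)
    (hP : ∀ p ∈ P, p.Prime ∧ p ∣ m) :
    ∏ p ∈ P, (1 + 1 / ((p : ℝ) - 1)) ≤ m / Nat.totient m := by
  have h1 : (m : ℝ) / Nat.totient m = ∏ p ∈ m.primeFactors, (1 + 1 / ((p : ℝ) - 1)) := by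
    have h2 : (Nat.totient m : ℝ) = m * ∏ p ∈ m.primeFactors, (1 - (p : ℝ)⁻¹) := by
      have h3 := congrArg (Rat.cast : ℚ → ℝ) (Nat.totient_eq_mul_prod_factors m)
      push_cast at h3
      exact h3
    have hm' : (m : ℝ) ≠ 0 := by exact_mod_cast hm
    rw [h2, div_mul_cancel_left₀ hm', ← prod_inv_distrib]
    refine prod_congr rfl fun p hp => ?_
    have h3 : (1 : ℝ) < p := by exact_mod_cast (Nat.prime_of_mem_primeFactors hp).one_lt
    have h4 : (p : ℝ) - 1 ≠ 0 := by linarith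
    have h5 : (p : ℝ) ≠ 0 := by linarith
    have h6 : 1 - (p : ℝ)⁻¹ = (p - 1) / p := by field_simp
    rw [h6]
    field_simp
    ring
  rw [h1]
  refine prod_le_prod_of_subset_of_one_le ?_ ?_ ?_
  · intro p hp
    exact Nat.mem_primeFactors.mpr ⟨(hP p hp).1, (hP p hp).2, hm⟩
  · intro p hp
    have h3 : (1 : ℝ) < p := by exact_mod_cast (hP p hp).1.one_lt
    have : 0 ≤ 1 / ((p : ℝ) - 1) := by
      apply div_nonneg <;> linarith
    linarith
  · intro p hp _
    have h3 : (1 : ℝ) < p := by exact_mod_cast (Nat.prime_of_mem_primeFactors hp).one_lt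
    have : 0 ≤ 1 / ((p : ℝ) - 1) := by
      apply div_nonneg <;> linarith
    linarith

theorem card_linearPair_sifted_le {h : ℕ} {a : ℤ} (hco : IsCoprime (h : ℤ) a)
    (h2 : (2 : ℤ) ∣ h * a) (hh : h ≠ 0) (ha : a ≠ 0) {N M : ℕ} (hM : 1 ≤ M)
    {S : Finset ℕ} (hS : S ⊆ range N)
    (hS' : ∀ n ∈ S, ∀ p : ℕ, p.Prime → p ≤ M → ¬ (p : ℤ) ∣ (n : ℤ) * (h * n - a)) :
    (#S : ℝ) ≤
      N * ((h * a.natAbs : ℕ) / (Nat.totient (h * a.natAbs) : ℝ)) / Real.log (M + 1) ^ 2 +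
        (M : ℝ) ^ 16 := by
  classical
  set s := linearPairSieve h a hco h2 N M with hs
  have hm : h * a.natAbs ≠ 0 := mul_ne_zero hh (Int.natAbs_ne_zero.mpr ha)
  have hM1 : (1 : ℝ) ≤ M := by exact_mod_cast hM
  have h3 : (1 : ℝ) ≤ ((M * M : ℕ) : ℝ) := by
    push_cast; nlinarith
  have h4 := BoundingSieve.siftedSum_le_selberg (s := s) h3
    (fun d hd => one_div_le_rootDensity h a
      (ne_zero_of_dvd_ne_zero BoundingSieve.prodPrimes_ne_zero hd))
    (fun d hd => abs_rem_linearPairSieve_le hco h2 N M hd)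
  have h5 : (#S : ℝ) ≤ s.siftedSum := by
    refine le_trans ?_ (le_of_eq (sum_image_fiber_card (fun n : ℕ => ((n : ℤ) * (h * n - a)).natAbs)
      (fun m => Nat.Coprime (primorial M) m) N).symm)
    refine Nat.cast_le.mpr (card_le_card fun n hn => mem_filter.mpr ⟨hS hn, ?_⟩)
    refine Nat.coprime_of_dvd fun p hp hpM hpn => hS' n hn p hp ?_ (Int.natCast_dvd.mpr hpn)
    exact (Nat.Prime.dvd_primorial_iff hp).mp hpM
  have h6 := log_sq_le_subsetSum (H := fun p : ℕ => (p : ℤ) ∣ h * a) (g := s.selbergTerms)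
    ((range (M + 1)).filter Nat.Prime) (fun p hp => (mem_filter.mp hp).2)
    (fun p hp hd => selbergTerms_linearPairSieve_of_dvd hco h2 N M (mem_filter.mp hp).2 hd)
    (fun p hp hd => selbergTerms_linearPairSieve_of_not_dvd hco h2 N M (mem_filter.mp hp).2 hd) M
    (fun p hp hpM => mem_filter.mpr ⟨mem_range.mpr (by omega), hp⟩)
  have h7 := subsetSum_le_selbergDenom hco h2 N M (M * M)
  rw [← hs] at h7
  set V := BoundingSieve.selbergDenom s ((M * M : ℕ) : ℝ)
  have hV : 1 ≤ V := BoundingSieve.one_le_selbergDenom h3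
  have h8 := prod_one_add_le_div_totient hm
    {p ∈ (range (M + 1)).filter Nat.Prime | (p : ℤ) ∣ h * a} (fun p hp => by
      have h9 := mem_filter.mp hp
      refine ⟨(mem_filter.mp h9.1).2, ?_⟩
      have h10 := Int.natCast_dvd.mp h9.2
      rwa [Int.natAbs_mul, Int.natAbs_natCast] at h10)
  set K := ((h * a.natAbs : ℕ) : ℝ) / (Nat.totient (h * a.natAbs) : ℝ)
  have hK : 0 ≤ K := by positivity
  have hL : 0 < Real.log (M + 1) := Real.log_pos (by linarith)
  have h9 : Real.log (M + 1) ^ 2 ≤ K * V :=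
    h6.trans (mul_le_mul h8 h7 (subsetSum_nonneg (fun p hp => by
      refine (BoundingSieve.selbergTerms_pos ?_).le
      exact (Nat.Prime.dvd_primorial_iff (mem_filter.mp hp).2).mpr
        (by have := mem_range.mp (mem_filter.mp hp).1; omega)) _) hK)
  refine (h5.trans h4).trans (add_le_add ?_ (le_of_eq ?_))
  · change (N : ℝ) / V ≤ _
    rw [div_le_div_iff₀ (by linarith) (by positivity), mul_assoc]
    gcongr
  · push_cast; ring

theorem card_linear_prime_pairs_le {h : ℕ} {a : ℤ} (h2 : (2 : ℤ) ∣ h * a) (hh : h ≠ 0)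
    (ha : a ≠ 0) {N M : ℕ} (hM : 1 ≤ M) {T : Finset ℕ} (hT : T ⊆ range N)
    (hT' : ∀ q ∈ T, q.Prime ∧ ∃ p : ℕ, p.Prime ∧ (p : ℤ) = h * q - a) :
    (#T : ℝ) ≤ N * ((h : ℝ) / h.totient * (a.natAbs / a.natAbs.totient)) / Real.log (M + 1) ^ 2 +
        3 * (M : ℝ) ^ 16 := by
  classical
  have hM1 : (1 : ℝ) ≤ M := by exact_mod_cast hM
  have hM16 : (M : ℝ) ≤ (M : ℝ) ^ 16 := le_self_pow₀ hM1 (by norm_num)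
  by_cases hco : IsCoprime (h : ℤ) a
  · set S := {q ∈ T | M < q ∧ (M : ℤ) < h * q - a} with hS
    set T1 := {q ∈ T | q ≤ M}
    set T2 := {q ∈ T | (h * (q : ℕ) - a : ℤ) ≤ M}
    have hcov : T ⊆ S ∪ (T1 ∪ T2) := by
      intro q hq
      simp only [S, T1, T2, mem_union, mem_filter]
      by_cases h1 : q ≤ M
      · exact Or.inr (Or.inl ⟨hq, h1⟩)
      · by_cases h3 : (h * q - a : ℤ) ≤ M
        · exact Or.inr (Or.inr ⟨hq, h3⟩)
        · exact Or.inl ⟨hq, by omega, by omega⟩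
    have hT1 : #T1 ≤ M := by
      calc #T1 ≤ #(Icc 1 M) := card_le_card fun q hq => by
            have h1 := mem_filter.mp hq
            exact mem_Icc.mpr ⟨(hT' q h1.1).1.one_le, h1.2⟩
        _ = M := by simp
    have hT2 : #T2 ≤ M := by
      calc #T2 ≤ #(Icc (1 : ℤ) M) := by
            refine card_le_card_of_injOn (fun q : ℕ => (h * q - a : ℤ)) (fun q hq => ?_) ?_
            · have h1 := mem_filter.mp hq
              obtain ⟨p, hp, hpq⟩ := (hT' q h1.1).2
              rw [mem_coe, mem_Icc]
              refine ⟨?_, h1.2⟩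
              simp only [← hpq]
              exact_mod_cast hp.one_le
            · intro q _ r _ hqr
              have h1 : (h : ℤ) * q = h * r := by simpa using hqr
              have h3 : (h : ℤ) ≠ 0 := by exact_mod_cast hh
              exact_mod_cast mul_left_cancel₀ h3 h1
        _ = M := by simp
    have hSc := card_linearPair_sifted_le hco h2 hh ha hM
      ((filter_subset (fun q : ℕ => M < q ∧ (M : ℤ) < h * q - a) T).trans hT) (fun q hq r hr hrM hdvd => by
        obtain ⟨hqT, hq1, hq2⟩ := mem_filter.mp hq
        obtain ⟨hqp, p, hp, hpq⟩ := hT' q hqT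
        rw [← hpq] at hdvd hq2
        have h3 : r ∣ q * p := by exact_mod_cast hdvd
        rcases (Nat.Prime.dvd_mul hr).mp h3 with h4 | h4
        · have := (Nat.prime_dvd_prime_iff_eq hr hqp).mp h4
          omega
        · have := (Nat.prime_dvd_prime_iff_eq hr hp).mp h4
          omega)
    rw [← hS] at hSc
    have hcop : Nat.Coprime h a.natAbs := by
      rw [Int.isCoprime_iff_gcd_eq_one] at hco
      exact hco
    rw [Nat.totient_mul hcop] at hSc
    push_cast at hSc
    rw [mul_div_mul_comm] at hSc
    have h9 : (#T : ℝ) ≤ #S + M + M := by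
      have := (card_le_card hcov).trans ((card_union_le _ _).trans
        (Nat.add_le_add_left (card_union_le _ _) _))
      exact_mod_cast (by omega : #T ≤ #S + M + M)
    linarith
  · have h1 : #T ≤ 1 := by
      rw [Int.isCoprime_iff_gcd_eq_one] at hco
      obtain ⟨r, hr, hrd⟩ := Nat.exists_prime_and_dvd hco
      have hrh : (r : ℤ) ∣ h := (Int.natCast_dvd_natCast.mpr hrd).trans (Int.gcd_dvd_left _ _)
      have hra : (r : ℤ) ∣ a := (Int.natCast_dvd_natCast.mpr hrd).trans (Int.gcd_dvd_right _ _)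
      have key : ∀ q ∈ T, (r : ℤ) = h * q - a := by
        intro q hq
        obtain ⟨-, p, hp, hpq⟩ := hT' q hq
        have h3 : (r : ℤ) ∣ p := by
          rw [hpq]
          exact dvd_sub (hrh.mul_right _) hra
        rw [(Nat.prime_dvd_prime_iff_eq hr hp).mp (by exact_mod_cast h3), hpq]
      rw [card_le_one]
      intro q hq q' hq'
      have h1 : (h : ℤ) * q = h * q' := by linarith [key q hq, key q' hq']
      have h3 : (h : ℤ) ≠ 0 := by exact_mod_cast hh
      exact_mod_cast mul_left_cancel₀ h3 h1
    have h1' : (#T : ℝ) ≤ 1 := by exact_mod_cast h1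
    have : 0 ≤ N * ((h : ℝ) / h.totient * (a.natAbs / a.natAbs.totient)) /
        Real.log (M + 1) ^ 2 := by positivity
    linarith

theorem card_proper_prime_powers_le (y : ℕ) {U : Finset ℕ}
    (hU : ∀ u ∈ U, IsPrimePow u ∧ ¬ u.Prime ∧ u ≤ y) : #U ≤ Nat.sqrt y * Nat.log 2 y := by
  have hsub : U ⊆ (Icc 1 (Nat.sqrt y) ×ˢ Icc 1 (Nat.log 2 y)).image (fun z => z.1 ^ z.2) := by
    intro u hu
    obtain ⟨hpp, hnp, huy⟩ := hU u hu
    obtain ⟨q, e, hq, he, rfl⟩ := (isPrimePow_nat_iff u).mp hpp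
    have he2 : 2 ≤ e := by
      by_contra h
      have : e = 1 := by omega
      rw [this, pow_one] at hnp
      exact hnp hq
    have hy0 : y ≠ 0 := by
      have : 0 < q ^ e := pow_pos hq.pos _
      omega
    refine mem_image.mpr ⟨(q, e), ?_, rfl⟩
    simp only [mem_product, mem_Icc]
    refine ⟨⟨hq.one_le, ?_⟩, he, ?_⟩
    · rw [Nat.le_sqrt']
      exact (Nat.pow_le_pow_right hq.pos he2).trans huy
    · exact Nat.le_log_of_pow_le (by norm_num) ((Nat.pow_le_pow_left hq.two_le e).trans huy)
  calc #U ≤ _ := card_le_card hsub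
    _ ≤ _ := card_image_le
    _ = _ := by simp

theorem one_le_div_totient {n : ℕ} (hn : n ≠ 0) : (1 : ℝ) ≤ n / n.totient := by
  have h1 : (0 : ℝ) < n.totient := by exact_mod_cast Nat.totient_pos.mpr (Nat.pos_of_ne_zero hn)
  rw [le_div_iff₀ h1, one_mul]
  exact_mod_cast Nat.totient_le n

theorem mul_div_totient_mul_le {s m : ℕ} (hs : s = 1 ∨ s = 2) (hm : m ≠ 0) :
    ((s * m : ℕ) : ℝ) / (s * m).totient ≤ 2 * (m / m.totient) := by
  have h1 : (0 : ℝ) < m.totient := by exact_mod_cast Nat.totient_pos.mpr (Nat.pos_of_ne_zero hm)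
  have h2 : m.totient ≤ (s * m).totient := by
    refine Nat.le_of_dvd (Nat.totient_pos.mpr ?_) (Nat.totient_dvd_of_dvd (dvd_mul_left _ _))
    rcases hs with rfl | rfl <;> omega
  rw [← mul_div_assoc]
  have h3 : ((s * m : ℕ) : ℝ) ≤ 2 * m := by
    have : s * m ≤ 2 * m := Nat.mul_le_mul_right _ (by omega)
    exact_mod_cast this
  gcongr

theorem card_prime_power_cofactors_le {a : ℤ} (ha : a ≠ 0) {s m : ℕ} (hs : s = 1 ∨ s = 2)
    (h2 : (2 : ℤ) ∣ s * a) (hm : m ≠ 0) {Y : ℝ} (hY : 2 ≤ Y) {U : Finset ℕ}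
    (hU : ∀ u ∈ U, IsPrimePow u ∧ (u : ℝ) ≤ Y ∧ ∃ p : ℕ, p.Prime ∧ (p : ℤ) = s * m * u - a) :
    (#U : ℝ) + 1 ≤ 5000 * (a.natAbs / a.natAbs.totient) * (m / m.totient) *
      (Y / Real.log Y ^ 2) := by
  classical
  set Ka : ℝ := a.natAbs / a.natAbs.totient with hKa
  set Km : ℝ := m / m.totient with hKm
  have hKa1 : 1 ≤ Ka := one_le_div_totient (Int.natAbs_ne_zero.mpr ha)
  have hKm1 : 1 ≤ Km := one_le_div_totient hm
  have hY0 : 0 < Y := by linarith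
  have hlog : 0 < Real.log Y := Real.log_pos (by linarith)
  set y := ⌊Y⌋₊ with hy
  have hyY : (y : ℝ) ≤ Y := Nat.floor_le hY0.le
  set M := ⌊Y ^ (1 / 32 : ℝ)⌋₊ with hMdef
  have hM : 1 ≤ M := by
    rw [hMdef, Nat.one_le_floor_iff]
    exact Real.one_le_rpow (by linarith) (by norm_num)
  have hMY : (M : ℝ) ≤ Y ^ (1 / 32 : ℝ) := Nat.floor_le (by positivity)
  have hM16 : (M : ℝ) ^ 16 ≤ √Y := by
    calc (M : ℝ) ^ 16 ≤ (Y ^ (1 / 32 : ℝ)) ^ 16 := by gcongr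
      _ = √Y := by
        rw [← Real.rpow_natCast, ← Real.rpow_mul hY0.le, Real.sqrt_eq_rpow]
        norm_num
  have hMlog : Real.log Y / 32 ≤ Real.log (M + 1) := by
    have h3 : Y ^ (1 / 32 : ℝ) ≤ M + 1 := (Nat.lt_floor_add_one _).le
    have h4 := Real.log_le_log (by positivity) h3
    rw [Real.log_rpow hY0] at h4
    linarith
  set U1 := {u ∈ U | u.Prime} with hU1
  set U2 := {u ∈ U | ¬ u.Prime} with hU2
  have hcard : #U = #U1 + #U2 := (card_filter_add_card_filter_not _).symm
  have hB1 : (#U1 : ℝ) ≤ (y + 1 : ℕ) * (((s * m : ℕ) : ℝ) / (s * m).totient * Ka) /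
      Real.log (M + 1) ^ 2 + 3 * (M : ℝ) ^ 16 := by
    refine card_linear_prime_pairs_le (h := s * m) (a := a) ?_ ?_ ha hM (T := U1) ?_ ?_
    · push_cast
      have : (s : ℤ) * m * a = s * a * m := by ring
      rw [this]
      exact h2.mul_right _
    · rcases hs with rfl | rfl <;> omega
    · intro u hu
      have h3 := (hU u (mem_filter.mp hu).1).2.1
      rw [mem_range]
      have := Nat.le_floor h3
      omega
    · intro u hu
      refine ⟨(mem_filter.mp hu).2, ?_⟩
      obtain ⟨p, hp, hpu⟩ := (hU u (mem_filter.mp hu).1).2.2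
      exact ⟨p, hp, by push_cast; exact hpu⟩
  have hB2 : (#U2 : ℝ) ≤ √Y * (2 * Real.log Y) := by
    have h3 := card_proper_prime_powers_le y (U := U2) (fun u hu => by
      have h4 := mem_filter.mp hu
      exact ⟨(hU u h4.1).1, h4.2, Nat.le_floor (hU u h4.1).2.1⟩)
    have h5 : (Nat.sqrt y : ℝ) ≤ √Y :=
      (Real.nat_sqrt_le_real_sqrt).trans (Real.sqrt_le_sqrt hyY)
    have hy0 : y ≠ 0 := by
      have : 1 ≤ y := by
        rw [hy, Nat.one_le_floor_iff]; linarith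
      omega
    have h6 : (Nat.log 2 y : ℝ) ≤ 2 * Real.log Y := by
      have h7 : ((2 ^ Nat.log 2 y : ℕ) : ℝ) ≤ Y :=
        (Nat.cast_le.mpr (Nat.pow_log_le_self 2 hy0)).trans hyY
      have h8 := Real.log_le_log (by positivity) h7
      push_cast at h8
      rw [Real.log_pow] at h8
      have h9 := Real.log_two_gt_d9
      have h10 : (0 : ℝ) ≤ Nat.log 2 y := by positivity
      nlinarith
    calc (#U2 : ℝ) ≤ (Nat.sqrt y * Nat.log 2 y : ℕ) := by exact_mod_cast h3
      _ ≤ _ := by push_cast; gcongr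
  set W := Y / Real.log Y ^ 2 with hW
  have hW0 : 0 < W := by positivity
  have hsq : √Y * √Y = Y := Real.mul_self_sqrt hY0.le
  have hsq1 : 1 ≤ √Y := Real.one_le_sqrt.mpr (by linarith)
  have hE1 : √Y ≤ 16 * W := by
    have h3 := Real.log_le_rpow_div hY0.le (ε := 1 / 4) (by norm_num)
    have h4 : Real.log Y ^ 2 ≤ 16 * √Y := by
      calc Real.log Y ^ 2 ≤ (Y ^ (1 / 4 : ℝ) / (1 / 4)) ^ 2 := by gcongr
        _ = 16 * (Y ^ (1 / 4 : ℝ)) ^ 2 := by ring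
        _ = 16 * √Y := by
          rw [← Real.rpow_natCast, ← Real.rpow_mul hY0.le, Real.sqrt_eq_rpow]
          norm_num
    rw [hW, ← mul_div_assoc, le_div_iff₀ (by positivity)]
    nlinarith
  have hE2 : √Y * (2 * Real.log Y) ≤ 432 * W := by
    have h3 := Real.log_le_rpow_div hY0.le (ε := 1 / 6) (by norm_num)
    have h4 : Real.log Y ^ 3 ≤ 216 * √Y := by
      calc Real.log Y ^ 3 ≤ (Y ^ (1 / 6 : ℝ) / (1 / 6)) ^ 3 := by gcongr
        _ = 216 * (Y ^ (1 / 6 : ℝ)) ^ 3 := by ring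
        _ = 216 * √Y := by
          rw [← Real.rpow_natCast, ← Real.rpow_mul hY0.le, Real.sqrt_eq_rpow]
          norm_num
    rw [hW, ← mul_div_assoc, le_div_iff₀ (by positivity)]
    calc √Y * (2 * Real.log Y) * Real.log Y ^ 2 = 2 * √Y * Real.log Y ^ 3 := by ring
      _ ≤ 2 * √Y * (216 * √Y) := by gcongr
      _ = 432 * (√Y * √Y) := by ring
      _ = 432 * Y := by rw [hsq]
  have hmain : (y + 1 : ℕ) * (((s * m : ℕ) : ℝ) / (s * m).totient * Ka) /
      Real.log (M + 1) ^ 2 ≤ 4096 * (Ka * Km) * W := by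
    have h3 : ((y + 1 : ℕ) : ℝ) ≤ 2 * Y := by push_cast; linarith
    calc _ ≤ 2 * Y * (2 * Km * Ka) / (Real.log Y / 32) ^ 2 := by
          gcongr
          exact mul_div_totient_mul_le hs hm
      _ = _ := by
          rw [hW]
          field_simp
          ring
  have hKK : 1 ≤ Ka * Km := by nlinarith
  have hKW : W ≤ Ka * Km * W := by nlinarith
  rw [hcard]
  push_cast
  have : 5000 * Ka * Km * W = 5000 * (Ka * Km * W) := by ring
  rw [this]
  have h10 : 4096 * (Ka * Km) * W = 4096 * (Ka * Km * W) := by ring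
  rw [h10] at hmain
  linarith

theorem factorial_mul_sum_le {F : ℕ → ℝ} (hF0 : ∀ n, 0 ≤ F n) (hF1 : F 1 = 1)
    (hFmul : ∀ m n, Nat.Coprime m n → F (m * n) = F m * F n) (L : ℕ) (P : Finset ℕ) :
    (∀ p ∈ P, p.Prime) → ∀ (r : ℕ) (A : Finset ℕ), (∀ m ∈ A, m ≠ 0 ∧ m.primeFactors.card = r ∧
      m.primeFactors ⊆ P ∧ ∀ p, m.factorization p ≤ L) →
    (r.factorial : ℝ) * ∑ m ∈ A, F m ≤ (∑ p ∈ P, ∑ i ∈ Icc 1 L, F (p ^ i)) ^ r := by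
  have hzero : ∀ A : Finset ℕ, (∀ m ∈ A, m ≠ 0 ∧ m.primeFactors.card = 0) →
      ∑ m ∈ A, F m ≤ 1 := by
    intro A hA
    have hsub : A ⊆ {1} := by
      intro m hm
      have h1 := hA m hm
      rw [card_eq_zero, Nat.primeFactors_eq_empty] at h1
      rw [mem_singleton]
      exact h1.2.resolve_left h1.1
    calc ∑ m ∈ A, F m ≤ ∑ m ∈ {1}, F m := sum_le_sum_of_subset_of_nonneg hsub fun _ _ _ => hF0 _
      _ = 1 := by simp [hF1]
  induction P using Finset.induction_on with
  | empty =>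
    intro _ r A hA
    rcases r with _ | r
    · simpa using hzero A fun m hm => ⟨(hA m hm).1, (hA m hm).2.1⟩
    · have : A = ∅ := by
        refine eq_empty_of_forall_notMem fun m hm => ?_
        obtain ⟨-, h1, h2, -⟩ := hA m hm
        rw [subset_empty.mp h2] at h1
        simp at h1
      simp [this]
  | insert p P hpP ih =>
    intro hP r A hA
    have hp := hP p (mem_insert_self p P)
    have ih := ih fun q hq => hP q (mem_insert_of_mem hq)
    rcases r with _ | r
    · simpa using hzero A fun m hm => ⟨(hA m hm).1, (hA m hm).2.1⟩
    set S := ∑ q ∈ P, ∑ i ∈ Icc 1 L, F (q ^ i) with hS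
    set g := ∑ i ∈ Icc 1 L, F (p ^ i) with hg
    have hS0 : 0 ≤ S := sum_nonneg fun _ _ => sum_nonneg fun _ _ => hF0 _
    have hg0 : 0 ≤ g := sum_nonneg fun _ _ => hF0 _
    rw [sum_insert hpP]
    set A1 := {m ∈ A | p ∣ m} with hA1
    set A0 := {m ∈ A | ¬ p ∣ m} with hA0
    set A2 := A1.image (fun m => ordCompl[p] m) with hA2
    have hsplit : ∑ m ∈ A, F m = ∑ m ∈ A1, F m + ∑ m ∈ A0, F m :=
      (sum_filter_add_sum_filter_not _ _ _).symm
    have h0 := ih (r + 1) A0 (fun m hm => by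
      obtain ⟨hmA, hpm⟩ := mem_filter.mp hm
      obtain ⟨h1, h2, h3, h4⟩ := hA m hmA
      refine ⟨h1, h2, fun q hq => ?_, h4⟩
      rcases mem_insert.mp (h3 hq) with rfl | h5
      · exact absurd (Nat.dvd_of_mem_primeFactors hq) hpm
      · exact h5)
    have h2 := ih r A2 (fun n hn => by
      obtain ⟨m, hm, rfl⟩ := mem_image.mp hn
      obtain ⟨hmA, hpm⟩ := mem_filter.mp hm
      obtain ⟨h1, h2, h3, h4⟩ := hA m hmA
      have h5 : (ordCompl[p] m).primeFactors = m.primeFactors.erase p := by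
        rw [← Nat.support_factorization, Nat.factorization_ordCompl, Finsupp.support_erase,
          Nat.support_factorization]
      refine ⟨(Nat.ordCompl_pos p h1).ne', ?_, ?_, ?_⟩
      · rw [h5, card_erase_of_mem (Nat.mem_primeFactors.mpr ⟨hp, hpm, h1⟩), h2]
        rfl
      · rw [h5]
        intro q hq
        rw [mem_erase] at hq
        exact (mem_insert.mp (h3 hq.2)).resolve_left hq.1
      · intro q
        rw [Nat.factorization_ordCompl, Finsupp.erase_apply]
        split_ifs
        · exact Nat.zero_le _
        · exact h4 q)
    have h1 : ∑ m ∈ A1, F m ≤ g * ∑ n ∈ A2, F n := by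
      rw [hg, sum_mul_sum, ← sum_product']
      have hinj : Set.InjOn (fun m => (m.factorization p, ordCompl[p] m)) (A1 : Set ℕ) := by
        intro m _ n _ hmn
        simp only [Prod.mk.injEq] at hmn
        rw [← Nat.ordProj_mul_ordCompl_eq_self m p, ← Nat.ordProj_mul_ordCompl_eq_self n p,
          hmn.2, hmn.1]
      calc ∑ m ∈ A1, F m = ∑ z ∈ A1.image (fun m => (m.factorization p, ordCompl[p] m)),
            F (p ^ z.1) * F z.2 := by
            rw [sum_image hinj]
            refine sum_congr rfl fun m hm => ?_
            rw [← hFmul, Nat.ordProj_mul_ordCompl_eq_self]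
            exact (Nat.coprime_ordCompl hp (hA m (mem_filter.mp hm).1).1).pow_left _
        _ ≤ _ := by
            refine sum_le_sum_of_subset_of_nonneg ?_ fun _ _ _ => mul_nonneg (hF0 _) (hF0 _)
            intro z hz
            obtain ⟨m, hm, rfl⟩ := mem_image.mp hz
            obtain ⟨hmA, hpm⟩ := mem_filter.mp hm
            obtain ⟨h1, -, -, h4⟩ := hA m hmA
            rw [mem_product, mem_Icc]
            exact ⟨⟨hp.factorization_pos_of_dvd h1 hpm, h4 p⟩, mem_image_of_mem _ hm⟩
    have hbern : S ^ (r + 1) + (r + 1) * g * S ^ r ≤ (g + S) ^ (r + 1) := by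
      have := pow_add_mul_le_add_pow hS0 (b := g) (by linarith) (r + 1)
      push_cast at this
      rw [add_comm S g] at this
      linarith
    rw [hsplit, Nat.factorial_succ]
    rw [Nat.factorial_succ] at h0
    push_cast at h0 ⊢
    have h3 : ((r : ℝ) + 1) * r.factorial * ∑ m ∈ A1, F m ≤ (r + 1) * g * S ^ r := by
      calc _ ≤ ((r : ℝ) + 1) * r.factorial * (g * ∑ n ∈ A2, F n) := by gcongr
        _ = (r + 1) * g * (r.factorial * ∑ n ∈ A2, F n) := by ring
        _ ≤ _ := by gcongr
    linarith

theorem sum_log_div_prime_le {z : ℝ} (hz : 1 ≤ z) {P : Finset ℕ}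
    (hP : ∀ p ∈ P, p.Prime ∧ (p : ℝ) ≤ z) :
    ∑ p ∈ P, Real.log p / p ≤ Real.log z + Real.log 4 := by
  set N := ⌊z⌋₊ with hN
  have hNz : (N : ℝ) ≤ z := Nat.floor_le (by linarith)
  have hN1 : 1 ≤ N := by rwa [hN, Nat.one_le_floor_iff]
  have hN0 : (0 : ℝ) < N := by exact_mod_cast hN1
  have hPN : ∀ p ∈ P, p ≤ N := fun p hp => Nat.le_floor (hP p hp).2
  have hdvd : ∏ p ∈ P, p ^ (N / p) ∣ N.factorial := by
    refine Finset.prod_dvd_of_isRelPrime ?_ ?_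
    · intro p hp q hq hpq
      rw [Function.onFun, ← Nat.coprime_iff_isRelPrime]
      exact Nat.Coprime.pow _ _ ((Nat.coprime_primes (hP p hp).1 (hP q hq).1).mpr hpq)
    · intro p hp
      rw [(hP p hp).1.pow_dvd_factorial_iff (Nat.lt_succ_self _)]
      have hmem : 1 ∈ Ico 1 (Nat.log p N).succ := by
        rw [mem_Ico]
        have := Nat.log_pos (hP p hp).1.one_lt (hPN p hp)
        omega
      simpa using single_le_sum (f := fun i => N / p ^ i) (fun _ _ => Nat.zero_le _) hmem
  have h1 : ∑ p ∈ P, ((N / p : ℕ) : ℝ) * Real.log p ≤ N * Real.log N := by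
    have h2 : ∏ p ∈ P, p ^ (N / p) ≤ N ^ N :=
      (Nat.le_of_dvd (Nat.factorial_pos _) hdvd).trans (Nat.factorial_le_pow N)
    have h3 : ((∏ p ∈ P, p ^ (N / p) : ℕ) : ℝ) ≤ ((N ^ N : ℕ) : ℝ) := by exact_mod_cast h2
    have hpos : ∀ p ∈ P, ((p : ℝ) ^ (N / p)) ≠ 0 := fun p hp => by
      have := (hP p hp).1.ne_zero
      positivity
    push_cast at h3
    have h4 := Real.log_le_log (lt_of_le_of_ne (prod_nonneg fun p _ => by positivity)
      (prod_ne_zero_iff.mpr hpos).symm) h3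
    rw [Real.log_prod hpos, Real.log_pow] at h4
    simpa only [Real.log_pow] using h4
  have h2 : ∑ p ∈ P, Real.log p ≤ Real.log 4 * N := by
    refine le_trans ?_ (Chebyshev.theta_le_log4_mul_x hN0.le)
    rw [Chebyshev.theta]
    refine sum_le_sum_of_subset_of_nonneg ?_ fun p _ _ => Real.log_natCast_nonneg p
    intro p hp
    rw [mem_filter, mem_Ioc, Nat.floor_natCast]
    exact ⟨⟨(hP p hp).1.pos, hPN p hp⟩, (hP p hp).1⟩
  have h3 : N * ∑ p ∈ P, Real.log p / p ≤ N * Real.log N + Real.log 4 * N := by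
    refine le_trans ?_ (add_le_add h1 h2)
    rw [mul_sum, ← sum_add_distrib]
    refine sum_le_sum fun p hp => ?_
    have hp0 : (0 : ℝ) < p := by exact_mod_cast (hP p hp).1.pos
    have h4 : (N : ℝ) / p ≤ (N / p : ℕ) + 1 := by
      rw [← Nat.floor_div_eq_div (K := ℝ)]
      exact (Nat.lt_floor_add_one _).le
    calc (N : ℝ) * (Real.log p / p) = N / p * Real.log p := by ring
      _ ≤ ((N / p : ℕ) + 1) * Real.log p :=
        mul_le_mul_of_nonneg_right h4 (Real.log_natCast_nonneg p)
      _ = _ := by ring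
  have h4 : ∑ p ∈ P, Real.log p / p ≤ Real.log N + Real.log 4 := by
    have : N * ∑ p ∈ P, Real.log p / p ≤ N * (Real.log N + Real.log 4) := by linarith
    exact le_of_mul_le_mul_left this hN0
  linarith [Real.log_le_log hN0 hNz]

theorem sum_Icc_pow_le {r : ℝ} (hr0 : 0 ≤ r) (hr1 : r < 1) (L : ℕ) :
    ∑ i ∈ Icc 1 L, r ^ i ≤ r / (1 - r) := by
  have h1 : 0 < 1 - r := by linarith
  have h2 : ∑ i ∈ Icc 1 L, r ^ i = (r - r ^ (L + 1)) / (1 - r) := by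
    induction L with
    | zero => simp
    | succ L ih =>
      rw [sum_Icc_succ_top (by omega), ih]
      field_simp
      ring
  rw [h2]
  gcongr
  have : 0 ≤ r ^ (L + 1) := by positivity
  linarith

theorem sum_prime_powers_le {p : ℕ} (hp : p.Prime) {δ : ℝ} (hδ : 0 ≤ δ)
    (hu : δ * Real.log p ≤ Real.log 2 / 2) (L : ℕ) :
    ∑ i ∈ Icc 1 L, ((p ^ i : ℕ) : ℝ) ^ δ / (p ^ i).totient ≤
      1 / p + 2 * δ * (Real.log p / p) + 30 * (1 / (p : ℝ) ^ 2) := by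
  have hp2 : (2 : ℝ) ≤ p := by exact_mod_cast hp.two_le
  have hp0 : (0 : ℝ) < p := by linarith
  have hp1 : (0 : ℝ) < p - 1 := by linarith
  have hlog : 0 ≤ Real.log p := Real.log_natCast_nonneg p
  set u := δ * Real.log p with hudef
  have hu0 : 0 ≤ u := by positivity
  have hlog2 := Real.log_two_lt_d9
  set t := (p : ℝ) ^ δ with ht
  have htu : t = Real.exp u := by
    rw [ht, Real.rpow_def_of_pos hp0, hudef, mul_comm]
  have ht1 : 1 ≤ t := by rw [htu]; exact Real.one_le_exp hu0
  have ht2 : t ≤ 3 / 2 := by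
    have h1 : t ^ 2 ≤ 2 := by
      rw [htu, ← Real.exp_nat_mul]
      calc Real.exp ((2 : ℕ) * u) ≤ Real.exp (Real.log 2) := by
            apply Real.exp_le_exp.mpr; push_cast; linarith
        _ = 2 := Real.exp_log (by norm_num)
    nlinarith
  have htu1 : t - 1 ≤ 2 * u := by
    have h1 := Real.abs_exp_sub_one_le (x := u) (by rw [abs_of_nonneg hu0]; linarith)
    rw [← htu, abs_of_nonneg hu0, abs_of_nonneg (by linarith)] at h1
    exact h1
  have hterm : ∀ i ∈ Icc 1 L, ((p ^ i : ℕ) : ℝ) ^ δ / (p ^ i).totient =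
      p / (p - 1) * (t / p) ^ i := by
    intro i hi
    obtain ⟨j, rfl⟩ : ∃ j, i = j + 1 := ⟨i - 1, by have := (mem_Icc.mp hi).1; omega⟩
    rw [Nat.totient_prime_pow_succ hp]
    push_cast [Nat.cast_sub hp.one_le]
    rw [← Real.rpow_natCast (p : ℝ) (j + 1), ← Real.rpow_mul hp0.le, mul_comm _ δ,
      Real.rpow_mul hp0.le, ← ht, Real.rpow_natCast, div_pow]
    field_simp
    ring
  rw [sum_congr rfl hterm, ← mul_sum]
  have htp : t / p < 1 := by rw [div_lt_one hp0]; linarith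
  have hgeo := sum_Icc_pow_le (r := t / p) (by positivity) htp L
  have hpt : 0 < p - t := by linarith
  have h1 : (p : ℝ) / (p - 1) * ∑ i ∈ Icc 1 L, (t / p) ^ i ≤
      p / (p - 1) * ((t / p) / (1 - t / p)) := by gcongr
  refine h1.trans ?_
  have h2 : (p : ℝ) / (p - 1) * ((t / p) / (1 - t / p)) =
      1 / p + (t - 1) / p + t * (p * (1 + t) - t) / (p * (p - 1) * (p - t)) := by
    have h3 : 1 - t / p = (p - t) / p := by field_simp
    rw [h3]
    field_simp
    ring
  rw [h2]
  have h4 : (t - 1) / p ≤ 2 * δ * (Real.log p / p) := by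
    calc (t - 1) / p ≤ 2 * u / p := by gcongr
      _ = _ := by rw [hudef]; ring
  have h5 : t * (p * (1 + t) - t) / (p * (p - 1) * (p - t)) ≤ 30 * (1 / (p : ℝ) ^ 2) := by
    rw [mul_one_div, div_le_div_iff₀ (by positivity) (by positivity)]
    have h6 : t * (p * (1 + t) - t) ≤ 15 / 4 * p := by
      have h7 : t * (1 + t) ≤ 15 / 4 := by nlinarith
      have h8 : t * (1 + t) * p ≤ 15 / 4 * p := by gcongr
      nlinarith
    have h7 : (p : ℝ) ^ 2 / 8 ≤ (p - 1) * (p - t) := by nlinarith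
    calc t * (p * (1 + t) - t) * (p : ℝ) ^ 2 ≤ 15 / 4 * p * p ^ 2 := by gcongr
      _ = 30 * (p * ((p : ℝ) ^ 2 / 8)) := by ring
      _ ≤ 30 * (p * ((p - 1) * (p - t))) := by gcongr
      _ = _ := by ring
  linarith

theorem sum_rpow_div_totient_le {Q : Finset ℕ} (hQ : ∀ p ∈ Q, p.Prime) {δ z : ℝ} (hδ : 0 ≤ δ)
    (hz : 1 ≤ z) (hδz : δ * Real.log z ≤ Real.log 2 / 2) (hδ2 : δ ≤ 1 / 2) {r : ℕ} {A : Finset ℕ}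
    (hA : ∀ m ∈ A, m ≠ 0 ∧ m.primeFactors.card = r ∧
      ∀ p ∈ m.primeFactors, p ∈ Q ∧ (p : ℝ) ≤ z) :
    (r.factorial : ℝ) * ∑ m ∈ A, (m : ℝ) ^ δ / m.totient ≤
      (∑ p ∈ Q, (1 : ℝ) / p + (3 + 30 * ∑' n : ℕ, 1 / (n : ℝ) ^ 2)) ^ r := by
  classical
  set P := {p ∈ Q | ((p : ℕ) : ℝ) ≤ z} with hP
  have hPp : ∀ p ∈ P, p.Prime ∧ (p : ℝ) ≤ z := fun p hp =>
    ⟨hQ p (mem_filter.mp hp).1, (mem_filter.mp hp).2⟩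
  set L := A.sup id
  have h1 := factorial_mul_sum_le (F := fun m : ℕ => (m : ℝ) ^ δ / m.totient)
    (fun n => by positivity) (by simp)
    (fun m n hmn => by
      rw [Nat.totient_mul hmn]
      push_cast
      rw [Real.mul_rpow (by positivity) (by positivity), mul_div_mul_comm]) L P
    (fun p hp => (hPp p hp).1) r A (fun m hm => by
      obtain ⟨h1, h2, h3⟩ := hA m hm
      refine ⟨h1, h2, fun p hp => mem_filter.mpr (h3 p hp), fun p => ?_⟩
      exact (Nat.factorization_lt p h1).le.trans (le_sup (f := id) hm))
  refine h1.trans (pow_le_pow_left₀ (sum_nonneg fun _ _ => sum_nonneg fun _ _ => by positivity)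
    ?_ r)
  have hsum : Summable fun n : ℕ => 1 / (n : ℝ) ^ 2 :=
    Real.summable_one_div_nat_pow.mpr (by norm_num)
  calc _ ≤ ∑ p ∈ P, (1 / (p : ℝ) + 2 * δ * (Real.log p / p) + 30 * (1 / (p : ℝ) ^ 2)) := by
        refine sum_le_sum fun p hp => sum_prime_powers_le (hPp p hp).1 hδ ?_ L
        refine le_trans ?_ hδz
        gcongr
        · exact_mod_cast (hPp p hp).1.pos
        · exact (hPp p hp).2
    _ = ∑ p ∈ P, 1 / (p : ℝ) + 2 * δ * ∑ p ∈ P, Real.log p / p +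
        30 * ∑ p ∈ P, 1 / (p : ℝ) ^ 2 := by
        rw [sum_add_distrib, sum_add_distrib, mul_sum, mul_sum]
    _ ≤ ∑ p ∈ Q, 1 / (p : ℝ) + 2 * δ * (Real.log z + Real.log 4) +
        30 * ∑' n : ℕ, 1 / (n : ℝ) ^ 2 := by
        gcongr
        · exact filter_subset _ _
        · exact sum_log_div_prime_le hz hPp
        · exact hsum.sum_le_tsum P fun n _ => by positivity
    _ ≤ _ := by
        have h4 : Real.log 4 = 2 * Real.log 2 := by
          rw [show (4 : ℝ) = 2 ^ 2 by norm_num, Real.log_pow]; norm_num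
        have h5 := Real.log_two_lt_d9
        have h6 : 0 < Real.log 2 := Real.log_pos (by norm_num)
        have h7 : δ * Real.log 4 ≤ Real.log 2 := by rw [h4]; nlinarith
        nlinarith

theorem summable_sq_mul_exp {c : ℝ} (hc : 0 < c) :
    Summable fun j : ℕ => ((j : ℝ) + 1) ^ 2 * Real.exp (-(c * (j - 1))) := by
  have h1 : ‖Real.exp (-c)‖ < 1 := by
    rw [Real.norm_of_nonneg (Real.exp_nonneg _), Real.exp_lt_one_iff]
    linarith
  have h2 : Summable fun n : ℕ => (n : ℝ) ^ 2 * Real.exp (-c) ^ n :=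
    summable_pow_mul_geometric_of_norm_lt_one 2 h1
  have h3 := ((summable_nat_add_iff 1).mpr h2).mul_left (Real.exp (2 * c))
  have h4 : ∀ j : ℕ, Real.exp (-(c * (j - 1))) = Real.exp (2 * c) * Real.exp (-c) ^ (j + 1) := by
    intro j
    rw [← Real.exp_nat_mul, ← Real.exp_add]
    congr 1
    push_cast
    ring
  refine h3.congr fun j => ?_
  rw [h4]
  push_cast
  ring

theorem sum_inv_totient_mul_log_sq_le : ∃ C : ℝ, 0 < C ∧ ∀ (Q : Finset ℕ) (X : ℝ) (r : ℕ)
    (A : Finset ℕ), (∀ p ∈ Q, p.Prime) → 2 ≤ X →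
    (∀ m ∈ A, m ≠ 0 ∧ m.primeFactors.card = r ∧ 2 ≤ X / m ∧
      ∀ p ∈ m.primeFactors, p ∈ Q ∧ (p : ℝ) ≤ X / m) →
    ∑ m ∈ A, 1 / ((m.totient : ℝ) * Real.log (X / m) ^ 2) ≤
      C * (∑ p ∈ Q, (1 : ℝ) / p + (3 + 30 * ∑' n : ℕ, 1 / (n : ℝ) ^ 2)) ^ r /
        (r.factorial * Real.log X ^ 2) := by
  classical
  set c := Real.log 2 / 2 with hc
  have hlog2 : 0 < Real.log 2 := Real.log_pos (by norm_num)
  have hc0 : 0 < c := by positivity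
  set w : ℕ → ℝ := fun j => ((j : ℝ) + 1) ^ 2 * Real.exp (-(c * (j - 1))) with hw
  have hwsum : Summable w := summable_sq_mul_exp hc0
  have hw0 : ∀ j, 0 ≤ w j := fun j => by positivity
  refine ⟨∑' j, w j, ?_, ?_⟩
  · exact hwsum.tsum_pos hw0 0 (by positivity)
  intro Q X r A hQ hX hA
  have hX0 : 0 < X := by linarith
  have hlogX : 0 < Real.log X := Real.log_pos (by linarith)
  set G := (∑ p ∈ Q, (1 : ℝ) / p + (3 + 30 * ∑' n : ℕ, 1 / (n : ℝ) ^ 2)) ^ r with hG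
  have hG0 : 0 ≤ G := by
    have : 0 ≤ ∑' n : ℕ, 1 / (n : ℝ) ^ 2 := tsum_nonneg fun n => by positivity
    positivity
  have hr0 : (0 : ℝ) < r.factorial := by exact_mod_cast Nat.factorial_pos r
  set J : ℕ → ℕ := fun m => ⌊Real.log X / Real.log (X / m)⌋₊ with hJ
  have key : ∀ j ∈ A.image J, ∑ m ∈ A with J m = j,
      1 / ((m.totient : ℝ) * Real.log (X / m) ^ 2) ≤ w j * (G / (r.factorial * Real.log X ^ 2)) := by
    intro j hj
    have hfacts : ∀ m ∈ A, J m = j → 1 ≤ m ∧ Real.log 2 ≤ Real.log (X / m) ∧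
        Real.log (X / m) = Real.log X - Real.log m ∧ 1 ≤ j ∧
        j * Real.log (X / m) ≤ Real.log X ∧ Real.log X ≤ (j + 1) * Real.log (X / m) := by
      intro m hm hmj
      obtain ⟨h1, h2, h3, h4⟩ := hA m hm
      have hm1 : 1 ≤ m := Nat.pos_of_ne_zero h1
      have hm1' : (1 : ℝ) ≤ m := by exact_mod_cast hm1
      have h5 : Real.log 2 ≤ Real.log (X / m) := Real.log_le_log (by norm_num) h3
      have h6 : Real.log (X / m) = Real.log X - Real.log m :=
        Real.log_div hX0.ne' (by positivity)
      have h7 : 0 < Real.log (X / m) := by linarith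
      have h8 : 0 ≤ Real.log m := Real.log_nonneg hm1'
      refine ⟨hm1, h5, h6, ?_, ?_, ?_⟩
      · rw [← hmj, hJ]
        simp only
        rw [Nat.one_le_floor_iff, one_le_div h7]
        linarith
      · rw [← hmj, ← le_div_iff₀ h7]
        exact Nat.floor_le (by positivity)
      · rw [← hmj, ← div_le_iff₀ h7]
        exact (Nat.lt_floor_add_one _).le
    obtain ⟨m₀, hm₀, hm₀j⟩ := mem_image.mp hj
    obtain ⟨-, hm2, -, hj1, hm4, -⟩ := hfacts m₀ hm₀ hm₀j
    have hj1' : (1 : ℝ) ≤ j := by exact_mod_cast hj1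
    have hj0 : (0 : ℝ) < j := by linarith
    set δ := c * j / Real.log X with hδ
    have hδ0 : 0 ≤ δ := by positivity
    have hδlog : δ * (Real.log X / j) = c := by
      rw [hδ]; field_simp
    have hδ2 : δ ≤ 1 / 2 := by
      rw [hδ, div_le_iff₀ hlogX, hc]
      nlinarith
    have hB := sum_rpow_div_totient_le hQ (z := Real.exp (Real.log X / j)) hδ0
      (Real.one_le_exp (by positivity)) (by rw [Real.log_exp, hδlog]) hδ2 (r := r)
      (A := {m ∈ A | J m = j}) (fun m hm => by
        obtain ⟨hmA, hmj⟩ := mem_filter.mp hm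
        obtain ⟨h1, h2, h3, h4⟩ := hA m hmA
        obtain ⟨-, h5, -, -, h6, -⟩ := hfacts m hmA hmj
        refine ⟨h1, h2, fun p hp => ⟨(h4 p hp).1, ?_⟩⟩
        have hp0 : (0 : ℝ) < p := by exact_mod_cast (Nat.prime_of_mem_primeFactors hp).pos
        rw [← Real.log_le_iff_le_exp hp0, le_div_iff₀ hj0]
        have := Real.log_le_log hp0 (h4 p hp).2
        nlinarith)
    rw [← hG, ← le_div_iff₀' hr0] at hB
    calc _ ≤ ∑ m ∈ A with J m = j, (w j / Real.log X ^ 2) * ((m : ℝ) ^ δ / m.totient) := by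
          refine sum_le_sum fun m hm => ?_
          obtain ⟨hmA, hmj⟩ := mem_filter.mp hm
          obtain ⟨h1, h2, h3, -, h5, h6⟩ := hfacts m hmA hmj
          have h7 : 0 < Real.log (X / m) := by linarith
          have hm0 : (0 : ℝ) < m := by exact_mod_cast h1
          have ht : (0 : ℝ) < m.totient := by exact_mod_cast Nat.totient_pos.mpr h1
          have h8 : Real.exp (c * (j - 1)) ≤ (m : ℝ) ^ δ := by
            rw [Real.rpow_def_of_pos hm0, Real.exp_le_exp]
            have h9 : Real.log X / j * (j - 1) ≤ Real.log m := by
              rw [div_mul_eq_mul_div, div_le_iff₀ hj0]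
              nlinarith
            calc c * (j - 1) = δ * (Real.log X / j * (j - 1)) := by rw [← hδlog]; ring
              _ ≤ δ * Real.log m := by gcongr
              _ = _ := mul_comm _ _
          have h9 : 1 ≤ Real.exp (-(c * (j - 1))) * (m : ℝ) ^ δ := by
            calc (1 : ℝ) = Real.exp (-(c * (j - 1))) * Real.exp (c * (j - 1)) := by
                  rw [← Real.exp_add]; simp
              _ ≤ _ := by gcongr
          have h10 : 1 / Real.log (X / m) ^ 2 ≤ (j + 1) ^ 2 / Real.log X ^ 2 := by
            rw [div_le_div_iff₀ (by positivity) (by positivity), one_mul, ← mul_pow]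
            gcongr
          calc 1 / ((m.totient : ℝ) * Real.log (X / m) ^ 2)
              = 1 / m.totient * (1 / Real.log (X / m) ^ 2) * 1 := by field_simp
            _ ≤ 1 / m.totient * ((j + 1) ^ 2 / Real.log X ^ 2) *
                (Real.exp (-(c * (j - 1))) * (m : ℝ) ^ δ) := by gcongr
            _ = _ := by rw [hw]; ring
      _ = (w j / Real.log X ^ 2) * ∑ m ∈ A with J m = j, (m : ℝ) ^ δ / m.totient := by
          rw [mul_sum]
      _ ≤ (w j / Real.log X ^ 2) * (G / r.factorial) := by
          gcongr
      _ = _ := by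
          ring
  calc _ = ∑ j ∈ A.image J, ∑ m ∈ A with J m = j,
        1 / ((m.totient : ℝ) * Real.log (X / m) ^ 2) :=
        (sum_fiberwise_of_maps_to (fun m hm => mem_image_of_mem J hm) _).symm
    _ ≤ ∑ j ∈ A.image J, w j * (G / (r.factorial * Real.log X ^ 2)) := sum_le_sum key
    _ = (∑ j ∈ A.image J, w j) * (G / (r.factorial * Real.log X ^ 2)) := by rw [sum_mul]
    _ ≤ (∑' j, w j) * (G / (r.factorial * Real.log X ^ 2)) := by
        gcongr
        exact hwsum.sum_le_tsum _ fun j _ => hw0 j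
    _ = _ := by rw [mul_div_assoc]

theorem le_primeCounting_mul_log {x : ℝ} (hx : 2 ≤ x) :
    x ≤ 15 * Nat.primeCounting ⌊x⌋₊ * Real.log x := by
  set n := ⌊x⌋₊ with hn
  have hn2 : 2 ≤ n := Nat.le_floor (by exact_mod_cast hx)
  have hn2' : (2 : ℝ) ≤ n := by exact_mod_cast hn2
  have key : ∀ n : ℕ, 2 ≤ n → (n : ℝ) / 10 ≤ n * Real.log 2 - Real.log (n + 1) := by
    have h2 := Real.log_two_gt_d9
    intro n hn
    induction n, hn using Nat.le_induction with
    | base =>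
      have h1 := Real.one_sub_inv_le_log_of_pos (show (0 : ℝ) < 4 / 3 by norm_num)
      rw [Real.log_div (by norm_num) (by norm_num), show (4 : ℝ) = 2 ^ 2 by norm_num,
        Real.log_pow] at h1
      norm_num at h1 ⊢
      linarith
    | succ n hn ih =>
      have hn' : (2 : ℝ) ≤ n := by exact_mod_cast hn
      have h1 := Real.log_le_sub_one_of_pos (show (0 : ℝ) < (n + 1 + 1) / (n + 1) by positivity)
      rw [Real.log_div (by positivity) (by positivity)] at h1
      have h3 : ((n : ℝ) + 1 + 1) / (n + 1) - 1 ≤ 1 / 3 := by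
        rw [add_div, div_self (by positivity), add_sub_cancel_left]
        exact one_div_le_one_div_of_le (by norm_num) (by linarith)
      push_cast
      linarith
  have h1 := Chebyshev.pi_ge n
  have hlogn : 0 < Real.log n := Real.log_pos (by linarith)
  rw [div_le_iff₀ hlogn] at h1
  have h3 := key n hn2
  have h4 : x < n + 1 := Nat.lt_floor_add_one x
  have h5 : Real.log n ≤ Real.log x :=
    Real.log_le_log (by linarith) (Nat.floor_le (by linarith))
  have h6 : (Nat.primeCounting n : ℝ) * Real.log n ≤ Nat.primeCounting n * Real.log x := by gcongr
  linarith

/-- The largest prime factor of `n` (`0` if there is none). -/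
def maxPrimeFactor (n : ℕ) : ℕ := n.primeFactors.sup id

theorem maxPrimeFactor_mem {n : ℕ} (hn : n.primeFactors.Nonempty) :
    maxPrimeFactor n ∈ n.primeFactors := by
  obtain ⟨q, hq, hq'⟩ := exists_mem_eq_sup n.primeFactors hn id
  rw [maxPrimeFactor, hq']
  exact hq

theorem le_maxPrimeFactor {n p : ℕ} (hp : p ∈ n.primeFactors) : p ≤ maxPrimeFactor n :=
  le_sup (f := id) hp

/-- The part of `n` coprime to its largest prime factor. -/
def smoothPart (n : ℕ) : ℕ := ordCompl[maxPrimeFactor n] n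

/-- The power of its largest prime factor which exactly divides `n`. -/
def topPart (n : ℕ) : ℕ := ordProj[maxPrimeFactor n] n

theorem smoothPart_mul_topPart (n : ℕ) : smoothPart n * topPart n = n := by
  rw [mul_comm]
  exact Nat.ordProj_mul_ordCompl_eq_self n _

theorem smoothPart_facts {n : ℕ} (hn : n.primeFactors.Nonempty) :
    smoothPart n ≠ 0 ∧ (smoothPart n).primeFactors.card = n.primeFactors.card - 1 ∧
      IsPrimePow (topPart n) ∧
      ∀ p ∈ (smoothPart n).primeFactors, p ∈ n.primeFactors ∧ p ≤ topPart n := by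
  have hq := maxPrimeFactor_mem hn
  obtain ⟨hqp, hqn, hn0⟩ := Nat.mem_primeFactors.mp hq
  have hv : 0 < n.factorization (maxPrimeFactor n) := hqp.factorization_pos_of_dvd hn0 hqn
  have hfac : (smoothPart n).primeFactors = n.primeFactors.erase (maxPrimeFactor n) := by
    rw [smoothPart, ← Nat.support_factorization, Nat.factorization_ordCompl,
      Finsupp.support_erase, Nat.support_factorization]
  refine ⟨(Nat.ordCompl_pos _ hn0).ne', ?_, ?_, fun p hp => ?_⟩
  · rw [hfac, card_erase_of_mem hq]
  · exact (isPrimePow_nat_iff _).mpr ⟨_, _, hqp, hv, rfl⟩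
  · rw [hfac, mem_erase] at hp
    exact ⟨hp.2, (le_maxPrimeFactor hp.2).trans (Nat.le_self_pow hv.ne' _)⟩

theorem exists_card_shifted_primes_le : ∃ C₁ C₂ : ℝ, ∀ (a : ℤ) (s : ℕ) (x : ℝ) (k : ℕ)
    (Q B : Finset ℕ), a ≠ 0 → (s = 1 ∧ Even a ∨ s = 2 ∧ Odd a) → 2 * (a.natAbs : ℝ) ≤ x → 1 ≤ k →
    (∀ p ∈ Q, p.Prime) →
    (∀ p ∈ B, p.Prime ∧ (p : ℝ) ≤ x ∧ -a < (p : ℤ) ∧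
      (∀ q ∈ (((p : ℤ) + a).toNat / s).primeFactors, (q : ℝ) ≤ x → q ∈ Q) ∧
      (((p : ℤ) + a).toNat / s).primeFactors.card = k) →
    (#B : ℝ) ≤ C₁ * ((a.natAbs : ℝ) / (Nat.totient a.natAbs : ℝ)) *
      (Nat.primeCounting ⌊x⌋₊ : ℝ) * ((∑ p ∈ Q, (1 : ℝ) / p) + C₂) ^ (k - 1) /
        ((Nat.factorial (k - 1) : ℝ) * Real.log x) := by
  classical
  obtain ⟨C, hC, hCbound⟩ := sum_inv_totient_mul_log_sq_le
  refine ⟨112500 * C, 3 + 30 * ∑' n : ℕ, 1 / (n : ℝ) ^ 2, ?_⟩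
  intro a s x k Q B ha hs hax hk hQ hB
  have ha1 : (1 : ℝ) ≤ a.natAbs := by exact_mod_cast Int.natAbs_pos.mpr ha
  have hx : 2 ≤ x := by linarith
  have hlogx : 0 < Real.log x := Real.log_pos (by linarith)
  set X := 3 / 2 * x with hX
  set N : ℕ → ℕ := fun p => ((p : ℤ) + a).toNat / s with hN
  set A := B.image fun p => smoothPart (N p) with hA
  have hs12 : s = 1 ∨ s = 2 := by tauto
  have hs0 : 1 ≤ s := by omega
  have hsa : (2 : ℤ) ∣ s * a := by
    rcases hs with ⟨-, h⟩ | ⟨rfl, -⟩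
    · exact h.two_dvd.mul_left _
    · exact dvd_mul_right _ _
  have hNne : ∀ p ∈ B, (N p).primeFactors.Nonempty := fun p hp => by
    rw [← card_pos, (hB p hp).2.2.2.2]
    exact hk
  have hNX : ∀ p ∈ B, (N p : ℝ) ≤ X := fun p hp => by
    obtain ⟨-, hpx, hpa, -, -⟩ := hB p hp
    have h1 : N p ≤ p + a.natAbs := (Nat.div_le_self _ _).trans (by omega)
    have h2 : (N p : ℝ) ≤ p + a.natAbs := by exact_mod_cast h1
    linarith
  have hNeq : ∀ p ∈ B, p ≠ 2 → (p : ℤ) = s * N p - a := fun p hp hp2 => by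
    obtain ⟨hpp, -, hpa, -, -⟩ := hB p hp
    rcases hs with ⟨rfl, -⟩ | ⟨rfl, hodd⟩
    · simp only [hN, Nat.div_one]
      omega
    · obtain ⟨b, hb⟩ := hodd
      obtain ⟨c, hc⟩ := hpp.odd_of_ne_two hp2
      simp only [hN]
      omega
  have htop : ∀ p ∈ B, (topPart (N p) : ℝ) ≤ X / smoothPart (N p) ∧ 2 ≤ topPart (N p) := by
    intro p hp
    obtain ⟨h1, -, h3, -⟩ := smoothPart_facts (hNne p hp)
    have h4 : (0 : ℝ) < smoothPart (N p) := by exact_mod_cast Nat.pos_of_ne_zero h1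
    refine ⟨?_, h3.two_le⟩
    rw [le_div_iff₀ h4, mul_comm]
    have h5 := hNX p hp
    rw [← smoothPart_mul_topPart (N p)] at h5
    exact_mod_cast h5
  have hAfacts : ∀ m ∈ A, m ≠ 0 ∧ m.primeFactors.card = k - 1 ∧ 2 ≤ X / m ∧
      ∀ p ∈ m.primeFactors, p ∈ Q ∧ (p : ℝ) ≤ X / m := by
    intro m hm
    obtain ⟨p, hp, rfl⟩ := mem_image.mp hm
    obtain ⟨h1, h2, h3, h4⟩ := smoothPart_facts (hNne p hp)
    obtain ⟨h5, h6⟩ := htop p hp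
    have h6' : (2 : ℝ) ≤ topPart (N p) := by exact_mod_cast h6
    refine ⟨h1, by rw [h2, (hB p hp).2.2.2.2], h6'.trans h5, fun q hq => ⟨?_, ?_⟩⟩
    · refine (hB p hp).2.2.2.1 q (h4 q hq).1 ?_
      have h7 : q ≤ smoothPart (N p) := Nat.le_of_mem_primeFactors hq
      have h8 : q * 2 ≤ N p := by
        calc q * 2 ≤ smoothPart (N p) * topPart (N p) := Nat.mul_le_mul h7 h6
          _ = N p := smoothPart_mul_topPart _
      have h9 : (q : ℝ) * 2 ≤ N p := by exact_mod_cast h8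
      linarith [hNX p hp]
    · exact le_trans (by exact_mod_cast (h4 q hq).2) h5
  set Ka : ℝ := a.natAbs / a.natAbs.totient with hKa
  have hfiber : ∀ m ∈ A, (#{p ∈ B | smoothPart (N p) = m} : ℝ) ≤
      5000 * Ka * X * (1 / ((m.totient : ℝ) * Real.log (X / m) ^ 2)) := by
    intro m hm
    obtain ⟨hm0, -, hm2, -⟩ := hAfacts m hm
    set Bm := {p ∈ B | smoothPart (N p) = m} with hBm
    set U := (Bm.erase 2).image fun p => topPart (N p) with hU
    have hform : ∀ p ∈ Bm.erase 2, (p : ℤ) = s * m * topPart (N p) - a := by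
      intro p hp
      rw [mem_erase, hBm, mem_filter] at hp
      obtain ⟨hp2, hpB, rfl⟩ := hp
      have h1 := hNeq p hpB hp2
      rw [mul_assoc, ← Nat.cast_mul (smoothPart (N p)), smoothPart_mul_topPart]
      exact h1
    have hcardU : #(Bm.erase 2) = #U := by
      rw [hU, card_image_of_injOn]
      intro p hp q hq hpq
      have h1 := hform p hp
      have h2 := hform q hq
      simp only at hpq
      rw [hpq, ← h2] at h1
      exact_mod_cast h1
    have hcard : (#Bm : ℝ) ≤ #U + 1 := by
      rw [← hcardU]
      have := pred_card_le_card_erase (s := Bm) (a := 2)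
      exact_mod_cast (by omega : #Bm ≤ #(Bm.erase 2) + 1)
    have h1 := card_prime_power_cofactors_le ha hs12 hsa hm0 hm2 (U := U) (fun u hu => by
      obtain ⟨p, hp, rfl⟩ := mem_image.mp hu
      have h2 := hform p hp
      rw [mem_erase, hBm, mem_filter] at hp
      obtain ⟨hp2, hpB, rfl⟩ := hp
      exact ⟨(smoothPart_facts (hNne p hpB)).2.2.1, (htop p hpB).1, p, (hB p hpB).1, h2⟩)
    refine (hcard.trans h1).trans (le_of_eq ?_)
    have hm0' : (m : ℝ) ≠ 0 := by exact_mod_cast hm0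
    rw [← hKa]
    field_simp
  set G := ((∑ p ∈ Q, (1 : ℝ) / p) + (3 + 30 * ∑' n : ℕ, 1 / (n : ℝ) ^ 2)) ^ (k - 1) with hG
  have hG0 : 0 ≤ G := by
    have : 0 ≤ ∑' n : ℕ, 1 / (n : ℝ) ^ 2 := tsum_nonneg fun n => by positivity
    positivity
  have hKa0 : 0 ≤ Ka := by positivity
  have hr0 : (0 : ℝ) < (k - 1).factorial := by exact_mod_cast Nat.factorial_pos _
  have hlogX : Real.log x ≤ Real.log X := Real.log_le_log (by linarith) (by linarith)
  calc (#B : ℝ) = ∑ m ∈ A, (#{p ∈ B | smoothPart (N p) = m} : ℝ) := by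
        exact_mod_cast card_eq_sum_card_image _ B
    _ ≤ ∑ m ∈ A, 5000 * Ka * X * (1 / ((m.totient : ℝ) * Real.log (X / m) ^ 2)) :=
        sum_le_sum hfiber
    _ = 5000 * Ka * X * ∑ m ∈ A, 1 / ((m.totient : ℝ) * Real.log (X / m) ^ 2) := by rw [mul_sum]
    _ ≤ 5000 * Ka * X * (C * G / ((k - 1).factorial * Real.log X ^ 2)) := by
        gcongr
        exact hCbound Q X (k - 1) A hQ (by linarith) hAfacts
    _ ≤ 5000 * Ka * (3 / 2 * (15 * Nat.primeCounting ⌊x⌋₊ * Real.log x)) *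
          (C * G / ((k - 1).factorial * Real.log x ^ 2)) := by
        gcongr
        exact mul_le_mul_of_nonneg_left (le_primeCounting_mul_log hx) (by norm_num)
    _ = _ := by
        field_simp
        ring

end SievedShiftedPrimes

open Finset
open scoped Classical

/-- Corollary 3: shifted primes `p + a` with `(p+a)/s ∈ 𝒬(ℰ)` and `ω((p+a)/s) = k`,
where `s = 2` if `a` is odd and `s = 1` if `a` is even, and `ℰ` is a nonempty set of
primes with `E(x) = ∑_{p ∈ ℰ, p ≤ x} 1/p`. -/
theorem shifted_primes_sifted_HardyRamanujan :
    ∃ C₁ C₂ : ℝ, ∀ (a : ℤ) (E : Set ℕ) (x : ℝ) (k : ℕ),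
      a ≠ 0 → (∀ p ∈ E, p.Prime) → E.Nonempty → 2 * (a.natAbs : ℝ) ≤ x → 1 ≤ k →
      (((Finset.Iic ⌊x⌋₊).filter
          (fun p : ℕ => p.Prime ∧ -a < (p : ℤ) ∧
            (∀ q ∈ ((((p : ℤ) + a).toNat / (if Odd a then 2 else 1)) : ℕ).primeFactors, q ∈ E) ∧
            ((((p : ℤ) + a).toNat / (if Odd a then 2 else 1)).primeFactors.card = k))).card : ℝ)
        ≤ C₁ * ((a.natAbs : ℝ) / (Nat.totient a.natAbs : ℝ)) * (Nat.primeCounting ⌊x⌋₊ : ℝ) *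
            ((∑ p ∈ (Finset.Iic ⌊x⌋₊).filter (fun p => p.Prime ∧ p ∈ E), (1 : ℝ) / p) + C₂) ^ (k - 1) /
            ((Nat.factorial (k - 1) : ℝ) * Real.log x) := by
  obtain ⟨C₁, C₂, h⟩ := SievedShiftedPrimes.exists_card_shifted_primes_le
  refine ⟨C₁, C₂, fun a E x k ha hE _ hax hk => ?_⟩
  have hx : 0 ≤ x := le_trans (by positivity) hax
  refine h a (if Odd a then 2 else 1) x k _ _ ha ?_ hax hk
    (fun p hp => (mem_filter.mp hp).2.1) fun p hp => ?_
  · split_ifs with hodd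
    · exact .inr ⟨rfl, hodd⟩
    · exact .inl ⟨rfl, Int.not_odd_iff_even.mp hodd⟩
  · simp only [mem_filter] at hp
    obtain ⟨hpx, hpp, hpa, hpE, hpk⟩ := hp
    refine ⟨hpp, (Nat.le_floor_iff hx).mp (mem_Iic.mp hpx), hpa, fun q hq hqx => ?_, hpk⟩
    exact mem_filter.mpr ⟨mem_Iic.mpr (Nat.le_floor hqx), Nat.prime_of_mem_primeFactors hq, hpE q hq⟩
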